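/- Let n ≥ 3, ν > n/2 − 1, 2 < p < ∞ and q < ∞ with q ≥ min{2·q_ν, q̃_{ν,p}}. Then there is no constant C > 0 such that ‖T_ν F‖_{L^{p,q}_ν} ≤ C·‖F‖_{L^{p,q}_ν} holds for all F ∈ L²_ν with ‖F‖_{L^{p,q}_ν} < ∞; that is, the weighted Bergman projection admits no bounded extension to L^{p,q}_ν. -/

import Mathlib

open MeasureTheory Complex Set
open scoped ENNReal NNReal

noncomputable section

def lorentzQ (n : ℕ) [NeZero n] (y : Fin n → ℝ) : ℝ :=
  y 0 ^ 2 - ∑ k ∈ Finset.univ.filter (fun k => k ≠ 0), y k ^ 2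

def lorentzQC (n : ℕ) [NeZero n] (z : Fin n → ℂ) : ℂ :=
  z 0 ^ 2 - ∑ k ∈ Finset.univ.filter (fun k => k ≠ 0), z k ^ 2

def lightCone (n : ℕ) [NeZero n] : Set (Fin n → ℝ) :=
  {y | 0 < y 0 ∧ 0 < lorentzQ n y}

def tubePt (n : ℕ) (x y : Fin n → ℝ) : Fin n → ℂ :=
  fun k => (x k : ℂ) + (y k : ℂ) * Complex.I

def inTube (n : ℕ) [NeZero n] (z : Fin n → ℂ) : Prop :=
  (fun k => (z k).im) ∈ lightCone n

def eVec (n : ℕ) [NeZero n] : Fin n → ℝ := fun k => if k = 0 then 1 else 0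

def mixedNorm (n : ℕ) [NeZero n] (p q ν : ℝ) (F : (Fin n → ℂ) → ℂ) : ℝ≥0∞ :=
  (∫⁻ y in lightCone n,
      (∫⁻ x : Fin n → ℝ, (‖F (tubePt n x y)‖₊ : ℝ≥0∞) ^ p) ^ (q / p)
        * ENNReal.ofReal (lorentzQ n y ^ (ν - (n : ℝ) / 2))) ^ (1 / q)

def bergmanIntegrand (n : ℕ) [NeZero n] (ν : ℝ) (F : (Fin n → ℂ) → ℂ) (z : Fin n → ℂ)
    (uv : (Fin n → ℝ) × (Fin n → ℝ)) : ℂ :=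
  lorentzQC n (fun k => (z k - ((uv.1 k : ℂ) - (uv.2 k : ℂ) * Complex.I)) / Complex.I)
      ^ (((-(ν + (n : ℝ) / 2) : ℝ)) : ℂ)
    * F (tubePt n uv.1 uv.2)
    * ((lorentzQ n uv.2 ^ (ν - (n : ℝ) / 2) : ℝ) : ℂ)

def bergmanOp (n : ℕ) [NeZero n] (ν : ℝ) (F : (Fin n → ℂ) → ℂ) (z : Fin n → ℂ) : ℂ :=
  ∫ uv in (univ ×ˢ lightCone n : Set ((Fin n → ℝ) × (Fin n → ℝ))),
    bergmanIntegrand n ν F z uv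

def qnu (n : ℕ) (ν : ℝ) : ℝ := (ν + (n : ℝ) / 2 - 1) / ((n : ℝ) / 2 - 1)

def pSharp (p : ℝ) : ℝ := if p ≤ 2 then p else p / (p - 1)

def qtilde (n : ℕ) (ν p : ℝ) : ℝ≥0∞ :=
  if 1 < (n : ℝ) / 2 * (1 - 1 / p) then
    ENNReal.ofReal ((ν + (n : ℝ) / 2 - 1) / ((n : ℝ) / 2 * (1 - 1 / p) - 1))
  else ∞

/-! ### Algebra of the Lorentz form -/

/-- The Lorentz bilinear form, the polarization of `lorentzQ`. -/
def lorentzB (n : ℕ) [NeZero n] (a b : Fin n → ℝ) : ℝ :=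
  a 0 * b 0 - ∑ k ∈ Finset.univ.filter (fun k => k ≠ 0), a k * b k

lemma lorentzQ_add (n : ℕ) [NeZero n] (a b : Fin n → ℝ) :
    lorentzQ n (a + b) = lorentzQ n a + 2 * lorentzB n a b + lorentzQ n b := by
  have h : ∑ k ∈ Finset.univ.filter (fun k : Fin n => k ≠ 0), (a k + b k) ^ 2
      = ∑ k ∈ Finset.univ.filter (fun k : Fin n => k ≠ 0), a k ^ 2
        + 2 * ∑ k ∈ Finset.univ.filter (fun k : Fin n => k ≠ 0), a k * b k
        + ∑ k ∈ Finset.univ.filter (fun k : Fin n => k ≠ 0), b k ^ 2 := by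
    rw [Finset.mul_sum, ← Finset.sum_add_distrib, ← Finset.sum_add_distrib]
    exact Finset.sum_congr rfl fun k _ => by ring
  simp only [lorentzQ, lorentzB, Pi.add_apply, h]
  ring

lemma lorentzQ_smul (n : ℕ) [NeZero n] (t : ℝ) (a : Fin n → ℝ) :
    lorentzQ n (t • a) = t ^ 2 * lorentzQ n a := by
  simp only [lorentzQ, Pi.smul_apply, smul_eq_mul, mul_pow, ← Finset.mul_sum]
  ring

lemma lorentzB_smul_smul (n : ℕ) [NeZero n] (s t : ℝ) (a b : Fin n → ℝ) :
    lorentzB n (s • a) (t • b) = s * t * lorentzB n a b := by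
  simp only [lorentzB, Pi.smul_apply, smul_eq_mul]
  rw [mul_sub, Finset.mul_sum]
  congr 1
  · ring
  · exact Finset.sum_congr rfl fun k _ => by ring

lemma lorentzQ_eVec (n : ℕ) [NeZero n] : lorentzQ n (eVec n) = 1 := by
  have : ∑ k ∈ Finset.univ.filter (fun k : Fin n => k ≠ 0), eVec n k ^ 2 = 0 :=
    Finset.sum_eq_zero fun k hk => by simp [eVec, (Finset.mem_filter.1 hk).2]
  simp [lorentzQ, this]
  simp [eVec]

lemma continuous_lorentzQ (n : ℕ) [NeZero n] : Continuous (lorentzQ n) := by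
  unfold lorentzQ
  fun_prop

lemma continuous_lorentzQC (n : ℕ) [NeZero n] : Continuous (lorentzQC n) := by
  unfold lorentzQC
  fun_prop

/-- Reversed Cauchy–Schwarz inequality in quadratic form. -/
lemma lorentzQ_reverse_cauchy (n : ℕ) [NeZero n] (a b : Fin n → ℝ) :
    a 0 ^ 2 * lorentzQ n b + b 0 ^ 2 * lorentzQ n a ≤ 2 * (a 0 * b 0 * lorentzB n a b) := by
  have h1 : lorentzQ n (b 0 • a + (-a 0) • b) ≤ 0 := by
    have : 0 ≤ ∑ k ∈ Finset.univ.filter (fun k : Fin n => k ≠ 0),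
        (b 0 • a + (-a 0) • b) k ^ 2 := Finset.sum_nonneg fun k _ => sq_nonneg _
    have h0 : (b 0 • a + (-a 0) • b) 0 = 0 := by simp; ring
    rw [lorentzQ, h0]
    linarith
  rw [lorentzQ_add, lorentzQ_smul, lorentzQ_smul, lorentzB_smul_smul] at h1
  nlinarith

lemma lorentzQ_le_add (n : ℕ) [NeZero n] {a b : Fin n → ℝ} (ha : a ∈ lightCone n)
    (hb : b ∈ lightCone n) : lorentzQ n b ≤ lorentzQ n (a + b) := by
  obtain ⟨a0, aQ⟩ := ha
  obtain ⟨b0, bQ⟩ := hb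
  have h := lorentzQ_reverse_cauchy n a b
  have hB : 0 ≤ lorentzB n a b := by
    by_contra! hneg
    have : a 0 * b 0 * lorentzB n a b < 0 := mul_neg_of_pos_of_neg (mul_pos a0 b0) hneg
    have := mul_pos (pow_pos a0 2) bQ
    have := mul_pos (pow_pos b0 2) aQ
    linarith
  rw [lorentzQ_add]
  linarith

lemma lorentzQC_ofReal_add_mul_I (n : ℕ) [NeZero n] (a b : Fin n → ℝ) :
    lorentzQC n (fun k => (a k : ℂ) + (b k : ℂ) * I)
      = ((lorentzQ n a - lorentzQ n b : ℝ) : ℂ) + ((2 * lorentzB n a b : ℝ) : ℂ) * I := by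
  have h : ∑ k ∈ Finset.univ.filter (fun k : Fin n => k ≠ 0), ((a k : ℂ) + (b k : ℂ) * I) ^ 2
      = ∑ k ∈ Finset.univ.filter (fun k : Fin n => k ≠ 0), (a k : ℂ) ^ 2
        + 2 * (∑ k ∈ Finset.univ.filter (fun k : Fin n => k ≠ 0), (a k : ℂ) * b k) * I
        - ∑ k ∈ Finset.univ.filter (fun k : Fin n => k ≠ 0), (b k : ℂ) ^ 2 := by
    rw [mul_assoc, Finset.sum_mul, Finset.mul_sum, ← Finset.sum_add_distrib,
      ← Finset.sum_sub_distrib]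
    refine Finset.sum_congr rfl fun k _ => ?_
    linear_combination (b k : ℂ) ^ 2 * I_sq
  simp only [lorentzQC, h, lorentzQ, lorentzB]
  push_cast
  linear_combination (b 0 : ℂ) ^ 2 * I_sq

lemma lorentzQ_le_norm_lorentzQC (n : ℕ) [NeZero n] {a : Fin n → ℝ} (ha : a ∈ lightCone n)
    (b : Fin n → ℝ) :
    lorentzQ n a ≤ ‖lorentzQC n (fun k => (a k : ℂ) + (b k : ℂ) * I)‖ := by
  obtain ⟨a0, aQ⟩ := ha
  rw [lorentzQC_ofReal_add_mul_I, Complex.norm_add_mul_I]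
  refine Real.le_sqrt_of_sq_le ?_
  have h := lorentzQ_reverse_cauchy n a b
  rcases le_or_gt (lorentzQ n b) 0 with hb | hb
  · nlinarith [sq_nonneg (lorentzB n a b), sq_nonneg (lorentzQ n b)]
  · have h2 : a 0 ^ 2 * (lorentzQ n a * lorentzQ n b) ≤ a 0 ^ 2 * lorentzB n a b ^ 2 := by
      nlinarith [sq_nonneg (a 0 * lorentzB n a b - b 0 * lorentzQ n a)]
    have h3 := le_of_mul_le_mul_left h2 (pow_pos a0 2)
    nlinarith [sq_nonneg (lorentzQ n b)]

/-- A linear map that scales the Lorentz form also scales its polarization. -/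
lemma lorentzB_map (n : ℕ) [NeZero n] {h : (Fin n → ℝ) →ₗ[ℝ] (Fin n → ℝ)} {t : ℝ}
    (hQ : ∀ y, lorentzQ n (h y) = t * lorentzQ n y) (a b : Fin n → ℝ) :
    lorentzB n (h a) (h b) = t * lorentzB n a b := by
  have h1 := hQ (a + b)
  rw [map_add, lorentzQ_add, lorentzQ_add, hQ, hQ] at h1
  linarith

lemma lorentzQC_map (n : ℕ) [NeZero n] {h : (Fin n → ℝ) →ₗ[ℝ] (Fin n → ℝ)} {t : ℝ}
    (hQ : ∀ y, lorentzQ n (h y) = t * lorentzQ n y) (a b : Fin n → ℝ) :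
    lorentzQC n (fun k => (h a k : ℂ) + (h b k : ℂ) * I)
      = (t : ℂ) * lorentzQC n (fun k => (a k : ℂ) + (b k : ℂ) * I) := by
  rw [lorentzQC_ofReal_add_mul_I, lorentzQC_ofReal_add_mul_I, hQ, hQ, lorentzB_map n hQ]
  push_cast
  ring

/-- The determinant of a linear map that scales the Lorentz form. -/
lemma sq_det_of_lorentzQ_map (n : ℕ) [NeZero n] {h : (Fin n → ℝ) →ₗ[ℝ] (Fin n → ℝ)} {t : ℝ}
    (hQ : ∀ y, lorentzQ n (h y) = t * lorentzQ n y) :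
    LinearMap.det h ^ 2 = t ^ n := by
  classical
  set d : Fin n → ℝ := fun k => if k = 0 then 1 else -1 with hd
  set J : Matrix (Fin n) (Fin n) ℝ := Matrix.diagonal d with hJ
  set M := LinearMap.toMatrix' h with hM
  have hB : ∀ a b : Fin n → ℝ, lorentzB n a b = ∑ k, a k * (d k * b k) := by
    intro a b
    rw [← Finset.sum_filter_add_sum_filter_not Finset.univ (fun k : Fin n => k ≠ 0)]
    have h1 : ∑ k ∈ Finset.univ.filter (fun k : Fin n => k ≠ 0), a k * (d k * b k)
        = - ∑ k ∈ Finset.univ.filter (fun k : Fin n => k ≠ 0), a k * b k := by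
      rw [← Finset.sum_neg_distrib]
      refine Finset.sum_congr rfl fun k hk => ?_
      simp [hd, (Finset.mem_filter.1 hk).2]
    have h2 : Finset.univ.filter (fun k : Fin n => ¬ k ≠ 0) = {0} := by
      ext k; simp
    rw [h1, h2, Finset.sum_singleton, lorentzB]
    simp [hd]
    ring
  have hmat : M.transpose * J * M = t • J := by
    ext i j
    have := lorentzB_map n hQ (Pi.single i 1) (Pi.single j 1)
    rw [hB, hB] at this
    rw [Matrix.mul_assoc, Matrix.mul_apply]
    simp only [hJ, Matrix.diagonal_mul, Matrix.transpose_apply, hM, LinearMap.toMatrix'_apply,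
      Matrix.smul_apply, smul_eq_mul]
    rw [← hJ]
    refine Eq.trans ?_ (this.trans ?_)
    · rfl
    · congr 1
      by_cases hij : i = j
      · subst hij
        simp [hJ, Pi.single_apply]
      · simp [hJ, Pi.single_apply, hij]
        exact fun hji => absurd hji.symm hij
  have hdet := congrArg Matrix.det hmat
  have hJ0 : J.det ≠ 0 := by
    rw [hJ, Matrix.det_diagonal]
    refine Finset.prod_ne_zero_iff.2 fun k _ => ?_
    simp only [hd]
    split_ifs <;> norm_num
  rw [Matrix.det_mul, Matrix.det_mul, Matrix.det_transpose, Matrix.det_smul, Fintype.card_fin]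
    at hdet
  have hMd : M.det = LinearMap.det h := LinearMap.det_toMatrix' h
  rw [hMd] at hdet
  refine mul_right_cancel₀ hJ0 ?_
  linarith

/-! ### Parabolic similarities of the light cone -/

/-- In the coordinates `a = y 0 + y 1`, `b = y 0 - y 1`, in which the Lorentz form is
`a * b - ∑ i, y (i + 2) ^ 2`, the linear map that contracts `a` by `s ^ 2` and the remaining
coordinates by `s`, followed by the unipotent transformation with parameter `-c`. -/
def parabolicMap (m : ℕ) (s : ℝ) (c : Fin m → ℝ) :
    (Fin (m + 2) → ℝ) →ₗ[ℝ] (Fin (m + 2) → ℝ) where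
  toFun y :=
    Fin.cons (((y 0 + y 1) / s ^ 2 + ((y 0 - y 1) - 2 * (∑ i, c i * (y i.succ.succ / s))
        + (y 0 + y 1) / s ^ 2 * ∑ i, c i ^ 2)) / 2)
      (Fin.cons (((y 0 + y 1) / s ^ 2 - ((y 0 - y 1) - 2 * (∑ i, c i * (y i.succ.succ / s))
        + (y 0 + y 1) / s ^ 2 * ∑ i, c i ^ 2)) / 2)
      (fun i => y i.succ.succ / s - (y 0 + y 1) / s ^ 2 * c i))
  map_add' x y := by
    have hs : ∑ i, c i * ((x i.succ.succ + y i.succ.succ) / s)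
        = ∑ i, c i * (x i.succ.succ / s) + ∑ i, c i * (y i.succ.succ / s) := by
      rw [← Finset.sum_add_distrib]
      exact Finset.sum_congr rfl fun i _ => by ring
    funext k
    refine Fin.cases ?_ (fun k => Fin.cases ?_ (fun k => ?_) k) k
    · simp only [hs, Fin.cons_zero, Pi.add_apply]; ring
    · simp only [hs, Fin.cons_zero, Fin.cons_succ, Pi.add_apply]; ring
    · simp only [Fin.cons_succ, Pi.add_apply]; ring
  map_smul' t y := by
    have hs : ∑ i, c i * (t * y i.succ.succ / s) = t * ∑ i, c i * (y i.succ.succ / s) := by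
      rw [Finset.mul_sum]
      exact Finset.sum_congr rfl fun i _ => by ring
    funext k
    refine Fin.cases ?_ (fun k => Fin.cases ?_ (fun k => ?_) k) k
    · simp only [hs, Fin.cons_zero, Pi.smul_apply, smul_eq_mul, RingHom.id_apply]; ring
    · simp only [hs, Fin.cons_zero, Fin.cons_succ, Pi.smul_apply, smul_eq_mul,
        RingHom.id_apply]; ring
    · simp only [Fin.cons_succ, Pi.smul_apply, smul_eq_mul, RingHom.id_apply]; ring

lemma parabolicMap_zero (m : ℕ) (s : ℝ) (c : Fin m → ℝ) (y : Fin (m + 2) → ℝ) :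
    parabolicMap m s c y 0
      = ((y 0 + y 1) / s ^ 2 + ((y 0 - y 1) - 2 * (∑ i, c i * (y i.succ.succ / s))
        + (y 0 + y 1) / s ^ 2 * ∑ i, c i ^ 2)) / 2 := rfl

lemma parabolicMap_one (m : ℕ) (s : ℝ) (c : Fin m → ℝ) (y : Fin (m + 2) → ℝ) :
    parabolicMap m s c y 1
      = ((y 0 + y 1) / s ^ 2 - ((y 0 - y 1) - 2 * (∑ i, c i * (y i.succ.succ / s))
        + (y 0 + y 1) / s ^ 2 * ∑ i, c i ^ 2)) / 2 := rfl

lemma parabolicMap_succ_succ (m : ℕ) (s : ℝ) (c : Fin m → ℝ) (y : Fin (m + 2) → ℝ) (i : Fin m) :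
    parabolicMap m s c y i.succ.succ = y i.succ.succ / s - (y 0 + y 1) / s ^ 2 * c i := rfl

lemma parabolicMap_zero_add_one (m : ℕ) (s : ℝ) (c : Fin m → ℝ) (y : Fin (m + 2) → ℝ) :
    parabolicMap m s c y 0 + parabolicMap m s c y 1 = (y 0 + y 1) / s ^ 2 := by
  rw [parabolicMap_zero, parabolicMap_one]
  ring

lemma lorentzQ_add_two (m : ℕ) [NeZero (m + 2)] (y : Fin (m + 2) → ℝ) :
    lorentzQ (m + 2) y = y 0 ^ 2 - y 1 ^ 2 - ∑ i : Fin m, y i.succ.succ ^ 2 := by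
  have : ∑ k ∈ Finset.univ.filter (fun k : Fin (m + 2) => k ≠ 0), y k ^ 2
      = y 1 ^ 2 + ∑ i : Fin m, y i.succ.succ ^ 2 := by
    rw [Finset.sum_filter, Fin.sum_univ_succ, Fin.sum_univ_succ]
    simp
  rw [lorentzQ, this]
  ring

lemma lorentzQ_parabolicMap (m : ℕ) [NeZero (m + 2)] (s : ℝ) (c : Fin m → ℝ)
    (y : Fin (m + 2) → ℝ) :
    lorentzQ (m + 2) (parabolicMap m s c y) = (s ^ 2)⁻¹ * lorentzQ (m + 2) y := by
  rw [lorentzQ_add_two, lorentzQ_add_two]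
  have h : ∑ i : Fin m, parabolicMap m s c y i.succ.succ ^ 2
      = (s ^ 2)⁻¹ * ∑ i : Fin m, y i.succ.succ ^ 2
        - 2 * ((y 0 + y 1) / s ^ 2) * ∑ i, c i * (y i.succ.succ / s)
        + ((y 0 + y 1) / s ^ 2) ^ 2 * ∑ i, c i ^ 2 := by
    rw [Finset.mul_sum, Finset.mul_sum, Finset.mul_sum, ← Finset.sum_sub_distrib,
      ← Finset.sum_add_distrib]
    refine Finset.sum_congr rfl fun i _ => ?_
    rw [parabolicMap_succ_succ]
    ring
  rw [h, parabolicMap_zero, parabolicMap_one]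
  ring

lemma norm_parabolicMap_le (m : ℕ) {s : ℝ} (hs : 1 ≤ s) {c : Fin m → ℝ}
    (hc : ∀ i, |c i| ≤ s) (y : Fin (m + 2) → ℝ) :
    ‖parabolicMap m s c y‖ ≤ (4 * m + 4) * ‖y‖ := by
  have hy : ∀ k, |y k| ≤ ‖y‖ := fun k => norm_le_pi_norm y k
  have hs0 : 0 < s := by linarith
  have hN : 0 ≤ ‖y‖ := norm_nonneg y
  have hm : (0 : ℝ) ≤ m := Nat.cast_nonneg m
  have hadd : |y 0 + y 1| ≤ 2 * ‖y‖ := by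
    have := abs_add_le (y 0) (y 1)
    linarith [hy 0, hy 1]
  have hsub : |y 0 - y 1| ≤ 2 * ‖y‖ := by
    have := abs_sub (y 0) (y 1)
    linarith [hy 0, hy 1]
  have hα : |(y 0 + y 1) / s ^ 2| ≤ 2 * ‖y‖ := by
    rw [abs_div, abs_of_pos (pow_pos hs0 2)]
    exact (div_le_self (abs_nonneg _) (one_le_pow₀ hs)).trans hadd
  have hcs : ∀ i, |c i / s| ≤ 1 := fun i => by
    rw [abs_div, abs_of_pos hs0]
    exact (div_le_one hs0).2 (hc i)
  have hS1 : |∑ i, c i * (y i.succ.succ / s)| ≤ m * ‖y‖ := by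
    refine (Finset.abs_sum_le_sum_abs _ _).trans ?_
    have : ∀ i ∈ (Finset.univ : Finset (Fin m)), |c i * (y i.succ.succ / s)| ≤ ‖y‖ := by
      intro i _
      have : c i * (y i.succ.succ / s) = c i / s * y i.succ.succ := by ring
      rw [this, abs_mul]
      calc |c i / s| * |y i.succ.succ| ≤ 1 * ‖y‖ :=
            mul_le_mul (hcs i) (hy _) (abs_nonneg _) zero_le_one
        _ = ‖y‖ := one_mul _
    refine (Finset.sum_le_card_nsmul _ _ _ this).trans ?_
    simp
  have hS2 : |(y 0 + y 1) / s ^ 2 * ∑ i, c i ^ 2| ≤ 2 * m * ‖y‖ := by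
    have h1 : (y 0 + y 1) / s ^ 2 * ∑ i, c i ^ 2 = (y 0 + y 1) * ∑ i, (c i / s) ^ 2 := by
      rw [Finset.mul_sum, Finset.mul_sum]
      exact Finset.sum_congr rfl fun i _ => by ring
    have h2 : ∑ i, (c i / s) ^ 2 ≤ m := by
      refine (Finset.sum_le_card_nsmul _ _ 1 fun i _ => ?_).trans ?_
      · exact (sq_le_one_iff_abs_le_one _).2 (hcs i)
      · simp
    have h3 : 0 ≤ ∑ i, (c i / s) ^ 2 := Finset.sum_nonneg fun i _ => sq_nonneg _
    rw [h1, abs_mul, abs_of_nonneg h3]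
    nlinarith [mul_le_mul hadd h2 h3 (by linarith)]
  refine (pi_norm_le_iff_of_nonneg (by positivity)).2 fun k => ?_
  rw [Real.norm_eq_abs]
  rw [abs_le] at hα hS1 hS2 hsub
  refine Fin.cases ?_ (fun k => Fin.cases ?_ (fun k => ?_) k) k
  · rw [parabolicMap_zero, abs_le]
    constructor <;> linarith
  · change |parabolicMap m s c y 1| ≤ _
    rw [parabolicMap_one, abs_le]
    constructor <;> linarith
  · rw [parabolicMap_succ_succ]
    have h1 : |y k.succ.succ / s| ≤ ‖y‖ := by
      rw [abs_div, abs_of_pos hs0]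
      exact (div_le_self (abs_nonneg _) hs).trans (hy _)
    have h2 : |(y 0 + y 1) / s ^ 2 * c k| ≤ 2 * ‖y‖ := by
      have : (y 0 + y 1) / s ^ 2 * c k = (y 0 + y 1) / s * (c k / s) := by ring
      rw [this, abs_mul]
      have h3 : |(y 0 + y 1) / s| ≤ 2 * ‖y‖ := by
        rw [abs_div, abs_of_pos hs0]
        exact (div_le_self (abs_nonneg _) hs).trans hadd
      calc _ ≤ 2 * ‖y‖ * 1 := mul_le_mul h3 (hcs k) (abs_nonneg _) (by linarith)
        _ = _ := mul_one _
    have := abs_sub (y k.succ.succ / s) ((y 0 + y 1) / s ^ 2 * c k)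
    nlinarith [mul_nonneg hm hN]

lemma mem_lightCone_of_parabolicMap_mem (m : ℕ) [NeZero (m + 2)] {s : ℝ} (hs : s ≠ 0)
    {c : Fin m → ℝ} {y : Fin (m + 2) → ℝ}
    (hy : parabolicMap m s c y ∈ lightCone (m + 2)) : y ∈ lightCone (m + 2) := by
  obtain ⟨h0, hQ⟩ := hy
  have hs2 : 0 < s ^ 2 := by positivity
  have hsum : 0 < parabolicMap m s c y 0 + parabolicMap m s c y 1 := by
    have h := hQ
    rw [lorentzQ_add_two] at h
    have : 0 ≤ ∑ i : Fin m, parabolicMap m s c y i.succ.succ ^ 2 :=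
      Finset.sum_nonneg fun i _ => sq_nonneg _
    have h0' : 0 < parabolicMap m s c y 0 := h0
    nlinarith
  rw [lorentzQ_parabolicMap m] at hQ
  have hQ' : 0 < lorentzQ (m + 2) y := pos_of_mul_pos_right hQ (by positivity)
  refine ⟨?_, hQ'⟩
  rw [parabolicMap_zero_add_one] at hsum
  have ha : 0 < y 0 + y 1 := by
    have := mul_pos hsum hs2
    rwa [div_mul_cancel₀ _ hs2.ne'] at this
  rw [lorentzQ_add_two] at hQ'
  have : 0 ≤ ∑ i : Fin m, y i.succ.succ ^ 2 := Finset.sum_nonneg fun i _ => sq_nonneg _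
  have h2 : 0 < (y 0 + y 1) * (y 0 - y 1) := by nlinarith
  have hb : 0 < y 0 - y 1 := pos_of_mul_pos_right h2 ha.le
  change 0 < y 0
  linarith

lemma det_parabolicMap (m : ℕ) {s : ℝ} (hs : 0 < s) (c : Fin m → ℝ) :
    |LinearMap.det (parabolicMap m s c)| = (s ^ (m + 2))⁻¹ := by
  have h := sq_det_of_lorentzQ_map (m + 2) (lorentzQ_parabolicMap m s c)
  have h2 : ((s ^ 2)⁻¹) ^ (m + 2) = ((s ^ (m + 2))⁻¹) ^ 2 := by
    rw [inv_pow, inv_pow, ← pow_mul, ← pow_mul, mul_comm]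
  rw [h2, sq_eq_sq_iff_abs_eq_abs, abs_of_pos (a := (s ^ (m + 2))⁻¹) (by positivity)] at h
  exact h

/-- The indices of the dyadic parabolic family up to scale `K`. -/
abbrev ParabolicIndex (m K : ℕ) : Type := Σ k : Fin K, Fin m → Fin (2 ^ (k : ℕ))

/-- The dyadic family of parabolic similarities. -/
def dyadicMap {m K : ℕ} (i : ParabolicIndex m K) : (Fin (m + 2) → ℝ) →ₗ[ℝ] (Fin (m + 2) → ℝ) :=
  parabolicMap m (2 ^ (i.1 : ℕ)) fun t => ((i.2 t : ℕ) : ℝ)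

/-- The bounded sets `{‖h y - e‖ ≤ 1 / 16}` for `h` in the dyadic family are pairwise disjoint. -/
lemma dyadicMap_separated {m K : ℕ} [NeZero (m + 2)] {i i' : ParabolicIndex m K}
    {y : Fin (m + 2) → ℝ}
    (hi : ‖dyadicMap i y - eVec (m + 2)‖ ≤ 1 / 16)
    (hi' : ‖dyadicMap i' y - eVec (m + 2)‖ ≤ 1 / 16) : i = i' := by
  obtain ⟨k, j⟩ := i
  obtain ⟨k', j'⟩ := i'
  have key : ∀ (l : Fin K) (c : Fin m → Fin (2 ^ (l : ℕ))),
      ‖dyadicMap (⟨l, c⟩ : ParabolicIndex m K) y - eVec (m + 2)‖ ≤ 1 / 16 →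
      |(y 0 + y 1) / (2 ^ (l : ℕ)) ^ 2 - 1| ≤ 1 / 8 ∧
      ∀ t, |y t.succ.succ / 2 ^ (l : ℕ) - (y 0 + y 1) / (2 ^ (l : ℕ)) ^ 2 * ((c t : ℕ) : ℝ)|
        ≤ 1 / 16 := by
    intro l c h
    have hk : ∀ t, |(dyadicMap (⟨l, c⟩ : ParabolicIndex m K) y - eVec (m + 2)) t| ≤ 1 / 16 :=
      fun t => (norm_le_pi_norm _ t).trans h
    constructor
    · have h0 := hk 0
      have h1 := hk 1
      rw [← parabolicMap_zero_add_one m (2 ^ (l : ℕ)) (fun t => ((c t : ℕ) : ℝ)) y]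
      simp only [Pi.sub_apply, eVec, dyadicMap] at h0 h1
      rw [if_pos trivial] at h0
      rw [if_neg (by simp)] at h1
      rw [abs_le] at h0 h1 ⊢
      constructor <;> linarith
    · intro t
      have h0 := hk t.succ.succ
      simp only [Pi.sub_apply, eVec, dyadicMap] at h0
      rw [if_neg (by exact Fin.succ_ne_zero _), sub_zero, parabolicMap_succ_succ] at h0
      exact h0
  obtain ⟨hk, hj⟩ := key k j hi
  obtain ⟨hk', hj'⟩ := key k' j' hi'
  have scale : ∀ l l' : Fin K, |(y 0 + y 1) / (2 ^ (l : ℕ)) ^ 2 - 1| ≤ 1 / 8 →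
      |(y 0 + y 1) / (2 ^ (l' : ℕ)) ^ 2 - 1| ≤ 1 / 8 → ¬ l < l' := by
    intro l l' hl hl' hlt
    have hlt' : (l : ℕ) + 1 ≤ (l' : ℕ) := hlt
    have hpow : (2 : ℝ) * 2 ^ (l : ℕ) ≤ 2 ^ (l' : ℕ) := by
      rw [← pow_succ']
      exact pow_le_pow_right₀ (by norm_num) hlt'
    have hp : (0 : ℝ) < 2 ^ (l : ℕ) := by positivity
    have hp' : (0 : ℝ) < 2 ^ (l' : ℕ) := by positivity
    rw [abs_le] at hl hl'
    have h1 : (y 0 + y 1) / (2 ^ (l : ℕ)) ^ 2 ≤ 9 / 8 := by linarith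
    have h2 : 7 / 8 ≤ (y 0 + y 1) / (2 ^ (l' : ℕ)) ^ 2 := by linarith
    rw [div_le_iff₀ (by positivity)] at h1
    rw [le_div_iff₀ (by positivity)] at h2
    nlinarith
  obtain rfl : k = k' := le_antisymm (not_lt.1 (scale k' k hk' hk)) (not_lt.1 (scale k k' hk hk'))
  congr 1
  funext t
  have ha : 7 / 8 ≤ (y 0 + y 1) / (2 ^ (k : ℕ)) ^ 2 := by
    rw [abs_le] at hk
    linarith
  have h1 := hj t
  have h2 := hj' t
  by_contra hne
  have hne' : ((j t : ℕ) : ℤ) - ((j' t : ℕ) : ℤ) ≠ 0 := by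
    intro h0
    exact hne (Fin.ext (by omega))
  have hge : (1 : ℝ) ≤ |((j t : ℕ) : ℝ) - ((j' t : ℕ) : ℝ)| := by
    have := Int.one_le_abs hne'
    exact_mod_cast this
  have h3 : |(y 0 + y 1) / (2 ^ (k : ℕ)) ^ 2 * (((j t : ℕ) : ℝ) - ((j' t : ℕ) : ℝ))| ≤ 1 / 8 := by
    rw [abs_le] at h1 h2 ⊢
    constructor <;> nlinarith
  rw [abs_mul, abs_of_pos (by linarith : 0 < (y 0 + y 1) / (2 ^ (k : ℕ)) ^ 2)] at h3
  nlinarith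

lemma lorentzQ_dyadicMap {m K : ℕ} [NeZero (m + 2)] (i : ParabolicIndex m K)
    (y : Fin (m + 2) → ℝ) :
    lorentzQ (m + 2) (dyadicMap i y) = ((4 : ℝ) ^ (i.1 : ℕ))⁻¹ * lorentzQ (m + 2) y := by
  rw [dyadicMap, lorentzQ_parabolicMap m, ← pow_mul, mul_comm (i.1 : ℕ), pow_mul]
  norm_num

lemma det_dyadicMap {m K : ℕ} (i : ParabolicIndex m K) :
    |LinearMap.det (dyadicMap i)| = (2 ^ ((i.1 : ℕ) * (m + 2)))⁻¹ := by
  rw [dyadicMap, det_parabolicMap m (by positivity), ← pow_mul]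

lemma norm_dyadicMap_le {m K : ℕ} (i : ParabolicIndex m K) (y : Fin (m + 2) → ℝ) :
    ‖dyadicMap i y‖ ≤ (4 * m + 4) * ‖y‖ := by
  refine norm_parabolicMap_le m (one_le_pow₀ (by norm_num)) (fun t => ?_) y
  rw [abs_of_nonneg (Nat.cast_nonneg _)]
  exact_mod_cast (i.2 t).2.le

lemma mem_lightCone_of_dyadicMap_mem {m K : ℕ} [NeZero (m + 2)] {i : ParabolicIndex m K}
    {y : Fin (m + 2) → ℝ} (hy : dyadicMap i y ∈ lightCone (m + 2)) : y ∈ lightCone (m + 2) :=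
  mem_lightCone_of_parabolicMap_mem m (by positivity) hy

lemma sum_parabolicIndex {m K : ℕ} {M : Type*} [AddCommMonoid M] (f : ℕ → M) :
    ∑ i : ParabolicIndex m K, f i.1 = ∑ k ∈ Finset.range K, (2 ^ (k * m)) • f k := by
  rw [Fintype.sum_sigma, Finset.sum_range]
  refine Finset.sum_congr rfl fun k _ => ?_
  simp [pow_mul]

/-! ### Mixed norms: Hölder lower bound and disjoint upper bound, choice of signs -/

lemma isOpen_lightCone (n : ℕ) [NeZero n] : IsOpen (lightCone n) :=
  (isOpen_lt continuous_const (continuous_apply 0)).inter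
    (isOpen_lt continuous_const (continuous_lorentzQ n))

lemma lintegral_le_rpow_mul_measure {α : Type*} [MeasurableSpace α] (μ : Measure α)
    {f : α → ℝ≥0∞} (hf : AEMeasurable f μ) {r : ℝ} (hr : 1 < r) :
    ∫⁻ x, f x ∂μ ≤ (∫⁻ x, f x ^ r ∂μ) ^ (1 / r) * μ univ ^ (1 - 1 / r) := by
  have hc : r.HolderConjugate (r / (r - 1)) := Real.HolderConjugate.conjExponent hr
  have h := ENNReal.lintegral_mul_le_Lp_mul_Lq μ hc hf (g := fun _ => 1) aemeasurable_const
  have h2 : 1 / (r / (r - 1)) = 1 - 1 / r := by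
    have : r ≠ 0 := by linarith
    have : r - 1 ≠ 0 := by linarith
    field_simp
  simpa [h2] using h

lemma lintegral_lintegral_sq_le_mixedNorm (n : ℕ) [NeZero n] {p q ν : ℝ} (hp : 2 < p) (hq : 2 < q)
    {G : (Fin n → ℂ) → ℂ}
    (hG : Measurable fun yx : (Fin n → ℝ) × (Fin n → ℝ) => G (tubePt n yx.2 yx.1))
    {X Y : Set (Fin n → ℝ)} (hY : MeasurableSet Y) (hYΛ : Y ⊆ lightCone n)
    {w : ℝ} (hw : 0 < w) (hwY : ∀ y ∈ Y, w ≤ lorentzQ n y ^ (ν - (n : ℝ) / 2)) :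
    ∫⁻ y in Y, ∫⁻ x in X, (‖G (tubePt n x y)‖₊ : ℝ≥0∞) ^ 2
      ≤ ((ENNReal.ofReal w)⁻¹ ^ (2 / q) * volume Y ^ (1 - 2 / q)) * volume X ^ (1 - 2 / p)
        * mixedNorm n p q ν G ^ 2 := by
  set A : (Fin n → ℝ) → ℝ≥0∞ :=
    fun y => ∫⁻ x : Fin n → ℝ, (‖G (tubePt n x y)‖₊ : ℝ≥0∞) ^ p with hA
  have hAm : Measurable A :=
    (hG.nnnorm.coe_nnreal_ennreal.pow_const p).lintegral_prod_right'
  have hp0 : 0 < p := by linarith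
  have hq0 : 0 < q := by linarith
  have inner : ∀ y, ∫⁻ x in X, (‖G (tubePt n x y)‖₊ : ℝ≥0∞) ^ 2
      ≤ A y ^ (2 / p) * volume X ^ (1 - 2 / p) := by
    intro y
    have hGy : Measurable fun x : Fin n → ℝ => G (tubePt n x y) :=
      hG.comp (measurable_const.prodMk measurable_id)
    have h := lintegral_le_rpow_mul_measure (volume.restrict X)
      (f := fun x => (‖G (tubePt n x y)‖₊ : ℝ≥0∞) ^ 2)
      (hGy.nnnorm.coe_nnreal_ennreal.pow_const 2).aemeasurable (r := p / 2) (by linarith)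
    refine h.trans ?_
    have e1 : ∀ x : Fin n → ℝ, ((‖G (tubePt n x y)‖₊ : ℝ≥0∞) ^ 2) ^ (p / 2)
        = (‖G (tubePt n x y)‖₊ : ℝ≥0∞) ^ p := by
      intro x
      rw [← ENNReal.rpow_natCast, ← ENNReal.rpow_mul]
      congr 1
      push_cast
      ring
    simp only [e1, one_div_div, Measure.restrict_apply_univ]
    gcongr
    exact setLIntegral_le_lintegral _ _
  have outer : ∫⁻ y in Y, A y ^ (2 / p)
      ≤ (∫⁻ y in Y, A y ^ (q / p)) ^ (2 / q) * volume Y ^ (1 - 2 / q) := by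
    have h := lintegral_le_rpow_mul_measure (volume.restrict Y) (f := fun y => A y ^ (2 / p))
      (hAm.pow_const _).aemeasurable (r := q / 2) (by linarith)
    refine h.trans (le_of_eq ?_)
    have e1 : ∀ y, (A y ^ (2 / p)) ^ (q / 2) = A y ^ (q / p) := by
      intro y
      rw [← ENNReal.rpow_mul]
      congr 1
      field_simp
    simp only [e1, one_div_div, Measure.restrict_apply_univ]
  have weight : ∫⁻ y in Y, A y ^ (q / p)
      ≤ (ENNReal.ofReal w)⁻¹ * mixedNorm n p q ν G ^ q := by
    have hw0 : ENNReal.ofReal w ≠ 0 := by simpa using hw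
    have e : mixedNorm n p q ν G ^ q
        = ∫⁻ y in lightCone n,
          A y ^ (q / p) * ENNReal.ofReal (lorentzQ n y ^ (ν - (n : ℝ) / 2)) := by
      rw [mixedNorm, ← ENNReal.rpow_mul, one_div_mul_cancel hq0.ne', ENNReal.rpow_one]
    rw [e, ← ENNReal.div_eq_inv_mul, ENNReal.le_div_iff_mul_le (Or.inl hw0)
      (Or.inl ENNReal.ofReal_ne_top), ← lintegral_mul_const' _ _ ENNReal.ofReal_ne_top]
    refine le_trans (setLIntegral_mono' hY fun y hy => ?_) (lintegral_mono_set hYΛ)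
    gcongr
    exact hwY y hy
  calc ∫⁻ y in Y, ∫⁻ x in X, (‖G (tubePt n x y)‖₊ : ℝ≥0∞) ^ 2
      ≤ ∫⁻ y in Y, A y ^ (2 / p) * volume X ^ (1 - 2 / p) := lintegral_mono fun y => inner y
    _ = (∫⁻ y in Y, A y ^ (2 / p)) * volume X ^ (1 - 2 / p) :=
        lintegral_mul_const _ (hAm.pow_const _)
    _ ≤ (((ENNReal.ofReal w)⁻¹ * mixedNorm n p q ν G ^ q) ^ (2 / q) * volume Y ^ (1 - 2 / q))
          * volume X ^ (1 - 2 / p) := by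
        gcongr
        exact outer.trans (by gcongr)
    _ = _ := by
        rw [ENNReal.mul_rpow_of_nonneg _ _ (by positivity), ← ENNReal.rpow_mul,
          mul_div_cancel₀ _ hq0.ne', ← ENNReal.rpow_natCast (mixedNorm n p q ν G)]
        push_cast
        ring

lemma mixedNorm_le_of_bound (n : ℕ) [NeZero n] {p q ν : ℝ} (hp : 0 < p) (hq : 0 < q)
    {ι : Type*} [Fintype ι] {U V : ι → Set (Fin n → ℝ)} {α W : ι → ℝ≥0∞}
    (hU : ∀ i, MeasurableSet (U i)) (hV : ∀ i, MeasurableSet (V i))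
    {F : (Fin n → ℂ) → ℂ}
    (hF : ∀ i, ∀ v ∈ V i, ∀ u,
      (‖F (tubePt n u v)‖₊ : ℝ≥0∞) ≤ (U i).indicator (fun _ => α i) u)
    (hF0 : ∀ v, (∀ i, v ∉ V i) → ∀ u, F (tubePt n u v) = 0)
    (hW : ∀ i, ∀ v ∈ V i, ENNReal.ofReal (lorentzQ n v ^ (ν - (n : ℝ) / 2)) ≤ W i) :
    mixedNorm n p q ν F
      ≤ (∑ i, (α i ^ p * volume (U i)) ^ (q / p) * (W i * volume (V i))) ^ (1 / q) := by
  rw [mixedNorm]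
  gcongr
  have hpt : ∀ v, (∫⁻ x : Fin n → ℝ, (‖F (tubePt n x v)‖₊ : ℝ≥0∞) ^ p) ^ (q / p)
        * ENNReal.ofReal (lorentzQ n v ^ (ν - (n : ℝ) / 2))
      ≤ ∑ i, (V i).indicator (fun _ => (α i ^ p * volume (U i)) ^ (q / p) * W i) v := by
    intro v
    by_cases hv : ∃ i, v ∈ V i
    · obtain ⟨i, hi⟩ := hv
      have h1 : ∫⁻ x : Fin n → ℝ, (‖F (tubePt n x v)‖₊ : ℝ≥0∞) ^ p ≤ α i ^ p * volume (U i) := by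
        calc ∫⁻ x : Fin n → ℝ, (‖F (tubePt n x v)‖₊ : ℝ≥0∞) ^ p
            ≤ ∫⁻ x, (U i).indicator (fun _ => α i ^ p) x := by
              refine lintegral_mono fun x => ?_
              refine (ENNReal.rpow_le_rpow (hF i v hi x) hp.le).trans (le_of_eq ?_)
              by_cases hx : x ∈ U i
              · simp [hx]
              · simp [hx, hp]
          _ = α i ^ p * volume (U i) := by
              rw [lintegral_indicator (hU i), setLIntegral_const]
      refine le_trans ?_ (Finset.single_le_sum (fun j _ => zero_le) (Finset.mem_univ i))
      rw [indicator_of_mem hi]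
      gcongr
      exact hW i v hi
    · push Not at hv
      have : ∀ x, F (tubePt n x v) = 0 := hF0 v hv
      simp [this, hp, div_pos hq hp]
  calc _ ≤ ∫⁻ v in lightCone n,
        ∑ i, (V i).indicator (fun _ => (α i ^ p * volume (U i)) ^ (q / p) * W i) v :=
        lintegral_mono fun v => hpt v
    _ ≤ ∫⁻ v, ∑ i, (V i).indicator (fun _ => (α i ^ p * volume (U i)) ^ (q / p) * W i) v :=
        setLIntegral_le_lintegral _ _
    _ = ∑ i, ∫⁻ v, (V i).indicator (fun _ => (α i ^ p * volume (U i)) ^ (q / p) * W i) v :=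
        lintegral_finsetSum _ fun i _ => measurable_const.indicator (hV i)
    _ = _ := by
        refine Finset.sum_congr rfl fun i _ => ?_
        rw [lintegral_indicator (hV i), setLIntegral_const, mul_assoc]

/-- Signs can be chosen so that the square function is dominated in `L²`. -/
lemma exists_signs_lintegral_sq {Ω J : Type*} [MeasurableSpace Ω] [DecidableEq J] (P : Measure Ω)
    (s : Finset J) {a : J → Ω → ℂ} (ha : ∀ j ∈ s, Measurable (a j)) :
    ∃ ε : J → ℂ, (∀ j, ‖ε j‖ = 1) ∧
      ∑ j ∈ s, ∫⁻ ω, (‖a j ω‖₊ : ℝ≥0∞) ^ 2 ∂P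
        ≤ ∫⁻ ω, (‖∑ j ∈ s, ε j * a j ω‖₊ : ℝ≥0∞) ^ 2 ∂P := by
  induction s using Finset.induction_on with
  | empty => exact ⟨fun _ => 1, fun _ => by simp, by simp⟩
  | insert i s hi ih =>
    obtain ⟨ε, hε, hle⟩ := ih fun j hj => ha j (Finset.mem_insert_of_mem hj)
    have hai : Measurable (a i) := ha i (Finset.mem_insert_self i s)
    set S : Ω → ℂ := fun ω => ∑ j ∈ s, ε j * a j ω with hS
    have hSm : Measurable S := Finset.measurable_fun_sum s fun j hj =>
      measurable_const.mul (ha j (Finset.mem_insert_of_mem hj))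
    have hpar : ∀ ω, (‖S ω + a i ω‖₊ : ℝ≥0∞) ^ 2 + (‖S ω - a i ω‖₊ : ℝ≥0∞) ^ 2
        = 2 * ((‖S ω‖₊ : ℝ≥0∞) ^ 2 + (‖a i ω‖₊ : ℝ≥0∞) ^ 2) := by
      intro ω
      have h := parallelogram_law_with_norm ℝ (S ω) (a i ω)
      have h' : ‖S ω + a i ω‖₊ ^ 2 + ‖S ω - a i ω‖₊ ^ 2
          = 2 * (‖S ω‖₊ ^ 2 + ‖a i ω‖₊ ^ 2) := by
        apply NNReal.eq
        push_cast
        exact h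
      exact_mod_cast congrArg (fun t : ℝ≥0 => (t : ℝ≥0∞)) h'
    have hparsum : ∫⁻ ω, (‖S ω + a i ω‖₊ : ℝ≥0∞) ^ 2 ∂P + ∫⁻ ω, (‖S ω - a i ω‖₊ : ℝ≥0∞) ^ 2 ∂P
        = 2 * (∫⁻ ω, (‖S ω‖₊ : ℝ≥0∞) ^ 2 ∂P + ∫⁻ ω, (‖a i ω‖₊ : ℝ≥0∞) ^ 2 ∂P) := by
      have m1 : Measurable fun ω => (‖S ω + a i ω‖₊ : ℝ≥0∞) ^ 2 :=
        (hSm.add hai).nnnorm.coe_nnreal_ennreal.pow_const 2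
      have m2 : Measurable fun ω => (‖S ω‖₊ : ℝ≥0∞) ^ 2 :=
        hSm.nnnorm.coe_nnreal_ennreal.pow_const 2
      have m3 : Measurable fun ω => (‖a i ω‖₊ : ℝ≥0∞) ^ 2 :=
        hai.nnnorm.coe_nnreal_ennreal.pow_const 2
      rw [← lintegral_add_left m1, ← lintegral_add_left m2]
      exact (lintegral_congr hpar).trans (lintegral_const_mul _ (m2.add m3))
    have hsign : ∃ δ : ℂ, ‖δ‖ = 1 ∧
        ∫⁻ ω, (‖S ω‖₊ : ℝ≥0∞) ^ 2 ∂P + ∫⁻ ω, (‖a i ω‖₊ : ℝ≥0∞) ^ 2 ∂P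
          ≤ ∫⁻ ω, (‖δ * a i ω + S ω‖₊ : ℝ≥0∞) ^ 2 ∂P := by
      by_contra! hcon
      have h1 := hcon 1 (by simp)
      have h2 := hcon (-1) (by simp)
      have e1 : ∀ ω, 1 * a i ω + S ω = S ω + a i ω := fun ω => by ring
      have e2 : ∀ ω, -1 * a i ω + S ω = S ω - a i ω := fun ω => by ring
      simp only [e1] at h1
      simp only [e2] at h2
      have h3 := ENNReal.add_lt_add h1 h2
      rw [hparsum, two_mul] at h3
      exact lt_irrefl _ h3
    obtain ⟨δ, hδ, hδle⟩ := hsign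
    refine ⟨fun j => if j = i then δ else ε j, fun j => ?_, ?_⟩
    · simp only
      split_ifs
      · exact hδ
      · exact hε j
    · rw [Finset.sum_insert hi]
      have e : ∀ ω, ∑ j ∈ insert i s, (if j = i then δ else ε j) * a j ω = δ * a i ω + S ω := by
        intro ω
        rw [Finset.sum_insert hi, if_pos rfl]
        congr 1
        refine Finset.sum_congr rfl fun j hj => ?_
        rw [if_neg (ne_of_mem_of_not_mem hj hi)]
      simp only [e]
      refine le_trans ?_ hδle
      rw [add_comm]
      gcongr

/-! ### The Bergman operator on indicator functions of product sets -/

/-- The set of points of `ℂ^n` with real part in `U` and imaginary part in `V`. -/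
def tubeProd {n : ℕ} (U V : Set (Fin n → ℝ)) : Set (Fin n → ℂ) :=
  {z | (fun k => (z k).re) ∈ U ∧ (fun k => (z k).im) ∈ V}

lemma tubePt_mem_tubeProd {n : ℕ} {U V : Set (Fin n → ℝ)} {x y : Fin n → ℝ} :
    tubePt n x y ∈ tubeProd U V ↔ x ∈ U ∧ y ∈ V := by
  simp [tubeProd, tubePt]

lemma measurableSet_tubeProd {n : ℕ} {U V : Set (Fin n → ℝ)} (hU : MeasurableSet U)
    (hV : MeasurableSet V) : MeasurableSet (tubeProd U V) := by
  have h1 : Measurable fun (z : Fin n → ℂ) k => (z k).re := by fun_prop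
  have h2 : Measurable fun (z : Fin n → ℂ) k => (z k).im := by fun_prop
  exact (h1 hU).inter (h2 hV)

lemma measurable_tubePt (n : ℕ) :
    Measurable fun p : (Fin n → ℝ) × (Fin n → ℝ) => tubePt n p.1 p.2 := by
  unfold tubePt
  fun_prop

lemma bergmanIntegrand_tubePt (n : ℕ) [NeZero n] (ν : ℝ) (F : (Fin n → ℂ) → ℂ)
    (x y u v : Fin n → ℝ) :
    bergmanIntegrand n ν F (tubePt n x y) (u, v)
      = lorentzQC n (fun k => ((y + v) k : ℂ) + ((u - x) k : ℂ) * I)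
          ^ (((-(ν + (n : ℝ) / 2) : ℝ)) : ℂ)
        * F (tubePt n u v) * ((lorentzQ n v ^ (ν - (n : ℝ) / 2) : ℝ) : ℂ) := by
  have : (fun k => (tubePt n x y k - ((u k : ℂ) - (v k : ℂ) * I)) / I)
      = fun k => ((y + v) k : ℂ) + ((u - x) k : ℂ) * I := by
    funext k
    rw [div_eq_iff I_ne_zero]
    simp only [tubePt, Pi.add_apply, Pi.sub_apply]
    push_cast
    linear_combination (-(u k : ℂ) + (x k : ℂ)) * I_sq
  rw [bergmanIntegrand]
  simp only [this]

lemma measurable_bergmanIntegrand (n : ℕ) [NeZero n] (ν : ℝ) {F : (Fin n → ℂ) → ℂ}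
    (hF : Measurable F) :
    Measurable fun p : (Fin n → ℂ) × ((Fin n → ℝ) × (Fin n → ℝ)) =>
      bergmanIntegrand n ν F p.1 p.2 := by
  have hQC : Measurable (lorentzQC n) := (continuous_lorentzQC n).measurable
  have hQ : Measurable (lorentzQ n) := (continuous_lorentzQ n).measurable
  have h1 : Measurable fun p : (Fin n → ℂ) × ((Fin n → ℝ) × (Fin n → ℝ)) =>
      fun k => (p.1 k - ((p.2.1 k : ℂ) - (p.2.2 k : ℂ) * I)) / I := by fun_prop
  unfold bergmanIntegrand
  refine (((hQC.comp h1).pow_const _).mul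
    (hF.comp ((measurable_tubePt n).comp measurable_snd))).mul ?_
  exact Complex.measurable_ofReal.comp
    ((hQ.comp (measurable_snd.comp measurable_snd)).pow_const _)

lemma measurable_bergmanIntegrand_right (n : ℕ) [NeZero n] (ν : ℝ) {F : (Fin n → ℂ) → ℂ}
    (hF : Measurable F) (z : Fin n → ℂ) : Measurable (bergmanIntegrand n ν F z) := by
  have hQC : Measurable (lorentzQC n) := (continuous_lorentzQC n).measurable
  have hQ : Measurable (lorentzQ n) := (continuous_lorentzQ n).measurable
  have h1 : Measurable fun p : (Fin n → ℝ) × (Fin n → ℝ) =>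
      fun k => (z k - ((p.1 k : ℂ) - (p.2 k : ℂ) * I)) / I := by fun_prop
  unfold bergmanIntegrand
  exact (((hQC.comp h1).pow_const _).mul (hF.comp (measurable_tubePt n))).mul
    (Complex.measurable_ofReal.comp ((hQ.comp measurable_snd).pow_const _))

lemma measurable_bergmanOp (n : ℕ) [NeZero n] (ν : ℝ) {F : (Fin n → ℂ) → ℂ}
    (hF : Measurable F) : Measurable (bergmanOp n ν F) := by
  have h := (measurable_bergmanIntegrand n ν hF).stronglyMeasurable.integral_prod_right'
    (ν := (volume : Measure ((Fin n → ℝ) × (Fin n → ℝ))).restrict (univ ×ˢ lightCone n))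
  exact h.measurable

/-- The hypotheses on a product set `U × V` in the tube under which the Bergman operator is
applied to its indicator function. -/
structure IsPacket (n : ℕ) [NeZero n] (U V : Set (Fin n → ℝ)) : Prop where
  measurableSet_left : MeasurableSet U
  measurableSet_right : MeasurableSet V
  volume_left_ne_top : volume U ≠ ∞
  volume_right_ne_top : volume V ≠ ∞
  subset_lightCone : V ⊆ lightCone n
  exists_bounds : ∃ l L : ℝ, 0 < l ∧ ∀ v ∈ V, l ≤ lorentzQ n v ∧ lorentzQ n v ≤ L

/-- The indicator function of a product set in the tube. -/
def packet {n : ℕ} (U V : Set (Fin n → ℝ)) : (Fin n → ℂ) → ℂ :=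
  (tubeProd U V).indicator fun _ => 1

lemma packet_tubePt_of_mem {n : ℕ} {U V : Set (Fin n → ℝ)} {u v : Fin n → ℝ} (hu : u ∈ U)
    (hv : v ∈ V) : packet U V (tubePt n u v) = 1 :=
  indicator_of_mem (tubePt_mem_tubeProd.2 ⟨hu, hv⟩) _

lemma packet_tubePt_of_notMem {n : ℕ} {U V : Set (Fin n → ℝ)} {u v : Fin n → ℝ}
    (h : ¬ (u ∈ U ∧ v ∈ V)) : packet U V (tubePt n u v) = 0 :=
  indicator_of_notMem (fun h' => h (tubePt_mem_tubeProd.1 h')) _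

lemma IsPacket.measurable {n : ℕ} [NeZero n] {U V : Set (Fin n → ℝ)} (h : IsPacket n U V) :
    Measurable (packet U V) :=
  measurable_const.indicator (measurableSet_tubeProd h.measurableSet_left h.measurableSet_right)

lemma rpow_le_max_rpow {l L t : ℝ} (hl : 0 < l) (h1 : l ≤ t) (h2 : t ≤ L) (a : ℝ) :
    t ^ a ≤ max (l ^ a) (L ^ a) := by
  rcases le_total 0 a with ha | ha
  · exact (Real.rpow_le_rpow (by linarith) h2 ha).trans (le_max_right _ _)
  · exact (Real.rpow_le_rpow_of_nonpos hl h1 ha).trans (le_max_left _ _)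

lemma min_rpow_le_rpow {l L t : ℝ} (hl : 0 < l) (h1 : l ≤ t) (h2 : t ≤ L) (a : ℝ) :
    min (l ^ a) (L ^ a) ≤ t ^ a := by
  rcases le_total 0 a with ha | ha
  · exact (min_le_left _ _).trans (Real.rpow_le_rpow hl.le h1 ha)
  · exact (min_le_right _ _).trans (Real.rpow_le_rpow_of_nonpos (by linarith) h2 ha)

lemma bergmanIntegrand_packet_eq_zero {n : ℕ} [NeZero n] (ν : ℝ) {U V : Set (Fin n → ℝ)}
    (z : Fin n → ℂ) {uv : (Fin n → ℝ) × (Fin n → ℝ)} (huv : uv ∉ U ×ˢ V) :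
    bergmanIntegrand n ν (packet U V) z uv = 0 := by
  have h0 : packet U V (tubePt n uv.1 uv.2) = 0 := packet_tubePt_of_notMem huv
  rw [bergmanIntegrand, h0]
  ring

lemma IsPacket.volume_prod_ne_top {n : ℕ} [NeZero n] {U V : Set (Fin n → ℝ)}
    (h : IsPacket n U V) :
    (volume : Measure ((Fin n → ℝ) × (Fin n → ℝ))) (U ×ˢ V) ≠ ∞ := by
  rw [Measure.volume_eq_prod, Measure.prod_prod]
  exact ENNReal.mul_ne_top h.volume_left_ne_top h.volume_right_ne_top

lemma IsPacket.integrableOn {n : ℕ} [NeZero n] {ν : ℝ} (hν : 0 ≤ ν + (n : ℝ) / 2)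
    {U V : Set (Fin n → ℝ)} (h : IsPacket n U V) {x y : Fin n → ℝ} (hy : y ∈ lightCone n) :
    IntegrableOn (bergmanIntegrand n ν (packet U V) (tubePt n x y)) (univ ×ˢ lightCone n) := by
  have hm : Measurable (bergmanIntegrand n ν (packet U V) (tubePt n x y)) :=
    measurable_bergmanIntegrand_right n ν h.measurable _
  obtain ⟨l, L, hl, hb⟩ := h.exists_bounds
  have hUV : MeasurableSet (U ×ˢ V) := h.measurableSet_left.prod h.measurableSet_right
  have hbound : ∀ uv ∈ U ×ˢ V, ‖bergmanIntegrand n ν (packet U V) (tubePt n x y) uv‖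
      ≤ l ^ (-(ν + (n : ℝ) / 2))
        * max (l ^ (ν - (n : ℝ) / 2)) (L ^ (ν - (n : ℝ) / 2)) := by
    rintro ⟨u, v⟩ ⟨hu, hv⟩
    have hu' : u ∈ U := hu
    have hv' : v ∈ V := hv
    obtain ⟨h1, h2⟩ := hb v hv'
    have hvΛ := h.subset_lightCone hv'
    rw [bergmanIntegrand_tubePt, packet_tubePt_of_mem hu' hv', mul_one, norm_mul,
      Complex.norm_cpow_real, Complex.norm_real,
      Real.norm_of_nonneg (Real.rpow_nonneg hvΛ.2.le _)]
    refine mul_le_mul ?_ (rpow_le_max_rpow hl h1 h2 _) (Real.rpow_nonneg hvΛ.2.le _)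
      (Real.rpow_nonneg hl.le _)
    refine Real.rpow_le_rpow_of_nonpos hl ?_ (by linarith)
    have hyv : y + v ∈ lightCone n :=
      ⟨add_pos hy.1 hvΛ.1, hvΛ.2.trans_le (lorentzQ_le_add n hy hvΛ)⟩
    exact h1.trans ((lorentzQ_le_add n hy hvΛ).trans (lorentzQ_le_norm_lorentzQC n hyv _))
  have hintegral : IntegrableOn (bergmanIntegrand n ν (packet U V) (tubePt n x y)) (U ×ˢ V) :=
    Measure.integrableOn_of_bounded h.volume_prod_ne_top hm.aestronglyMeasurable
      ((ae_restrict_iff' hUV).2 (Filter.Eventually.of_forall hbound))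
  refine IntegrableOn.of_forall_sdiff_eq_zero hintegral
    (MeasurableSet.univ.prod (isOpen_lightCone n).measurableSet) ?_
  exact fun uv huv => bergmanIntegrand_packet_eq_zero ν _ huv.2

lemma bergmanOp_sum_packet {n : ℕ} [NeZero n] {ν : ℝ} (hν : 0 ≤ ν + (n : ℝ) / 2) {J : Type*}
    (s : Finset J) (c : J → ℂ) {U V : J → Set (Fin n → ℝ)} (h : ∀ j ∈ s, IsPacket n (U j) (V j))
    {x y : Fin n → ℝ} (hy : y ∈ lightCone n) :
    bergmanOp n ν (fun z => ∑ j ∈ s, c j * packet (U j) (V j) z) (tubePt n x y)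
      = ∑ j ∈ s, c j * bergmanOp n ν (packet (U j) (V j)) (tubePt n x y) := by
  have e : ∀ uv, bergmanIntegrand n ν (fun z => ∑ j ∈ s, c j * packet (U j) (V j) z)
        (tubePt n x y) uv
      = ∑ j ∈ s, c j * bergmanIntegrand n ν (packet (U j) (V j)) (tubePt n x y) uv := by
    intro uv
    simp only [bergmanIntegrand, Finset.mul_sum, Finset.sum_mul]
    exact Finset.sum_congr rfl fun j _ => by ring
  simp only [bergmanOp, e]
  rw [integral_finsetSum]
  · exact Finset.sum_congr rfl fun j _ => integral_const_mul _ _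
  · exact fun j hj => ((h j hj).integrableOn hν hy).const_mul _

lemma IsPacket.le_re_bergmanOp {n : ℕ} [NeZero n] {ν : ℝ} (hν : 0 ≤ ν + (n : ℝ) / 2)
    {U V : Set (Fin n → ℝ)} (h : IsPacket n U V) {x y : Fin n → ℝ} (hy : y ∈ lightCone n)
    {κ w : ℝ} (hκ : 0 ≤ κ) (hw : 0 ≤ w)
    (hwV : ∀ v ∈ V, w ≤ lorentzQ n v ^ (ν - (n : ℝ) / 2))
    (hκUV : ∀ u ∈ U, ∀ v ∈ V, κ ≤ (lorentzQC n (fun k => ((y + v) k : ℂ) + ((u - x) k : ℂ) * I)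
          ^ (((-(ν + (n : ℝ) / 2) : ℝ)) : ℂ)).re) :
    κ * w * (volume.real U * volume.real V)
      ≤ (bergmanOp n ν (packet U V) (tubePt n x y)).re := by
  have hintegral := h.integrableOn (x := x) hν hy
  have hUV : MeasurableSet (U ×ˢ V) := h.measurableSet_left.prod h.measurableSet_right
  have hsub : U ×ˢ V ⊆ univ ×ˢ lightCone n := prod_mono (subset_univ U) h.subset_lightCone
  have e1 : bergmanOp n ν (packet U V) (tubePt n x y)
      = ∫ uv in U ×ˢ V, bergmanIntegrand n ν (packet U V) (tubePt n x y) uv :=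
    setIntegral_eq_of_subset_of_forall_sdiff_eq_zero
      (MeasurableSet.univ.prod (isOpen_lightCone n).measurableSet) hsub
      fun uv huv => bergmanIntegrand_packet_eq_zero ν _ huv.2
  have e2 : (bergmanOp n ν (packet U V) (tubePt n x y)).re
      = ∫ uv in U ×ˢ V, (bergmanIntegrand n ν (packet U V) (tubePt n x y) uv).re := by
    rw [e1]
    exact (integral_re (𝕜 := ℂ) (hintegral.mono_set hsub)).symm
  have hvol : volume.real (U ×ˢ V) = volume.real U * volume.real V := by
    rw [Measure.real, Measure.volume_eq_prod, Measure.prod_prod, ENNReal.toReal_mul]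
    rfl
  rw [e2, ← hvol]
  refine setIntegral_ge_of_const_le_real hUV h.volume_prod_ne_top ?_
    (hintegral.mono_set hsub).re
  rintro ⟨u, v⟩ ⟨hu, hv⟩
  have huU : u ∈ U := hu
  have hvV : v ∈ V := hv
  rw [bergmanIntegrand_tubePt, packet_tubePt_of_mem huU hvV, mul_one, Complex.re_mul_ofReal]
  exact mul_le_mul (hκUV u huU v hvV) (hwV v hvV) hw (hκ.trans (hκUV u huU v hvV))

/-- Near the base point of the cone the Bergman kernel is close to `1`. -/
lemma exists_kernel_bounds (n : ℕ) [NeZero n] (σ : ℝ) :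
    ∃ η : ℝ, 0 < η ∧ η ≤ 1 / 16 ∧
      (∀ a b : Fin n → ℝ, ‖a - eVec n‖ ≤ 2 * η → ‖b‖ ≤ 2 * η →
        1 / 2 ≤ (lorentzQC n (fun k => (a k : ℂ) + (b k : ℂ) * I) ^ ((-σ : ℝ) : ℂ)).re) ∧
      ∀ v : Fin n → ℝ, ‖v - eVec n‖ ≤ η →
        v ∈ lightCone n ∧ 1 / 2 ≤ lorentzQ n v ∧ lorentzQ n v ≤ 2 := by
  have hone : lorentzQC n (fun k => (eVec n k : ℂ) + (((0 : Fin n → ℝ) k : ℝ) : ℂ) * I) = 1 := by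
    rw [lorentzQC_ofReal_add_mul_I, lorentzQ_eVec]
    simp [lorentzQ, lorentzB]
  set f : (Fin n → ℝ) × (Fin n → ℝ) → ℝ := fun p =>
    (lorentzQC n (fun k => (p.1 k : ℂ) + (p.2 k : ℂ) * I) ^ ((-σ : ℝ) : ℂ)).re with hf
  have hf1 : f (eVec n, 0) = 1 := by
    simp only [hf, hone, Complex.one_cpow, Complex.one_re]
  have hfc : ContinuousAt f (eVec n, 0) := by
    refine Complex.continuous_re.continuousAt.comp (ContinuousAt.cpow ?_ continuousAt_const ?_)
    · refine ((continuous_lorentzQC n).comp ?_).continuousAt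
      fun_prop
    · simp only
      rw [hone]
      exact Complex.one_mem_slitPlane
  have h1 := hfc.eventually (lt_mem_nhds (by rw [hf1]; norm_num : (1 / 2 : ℝ) < f (eVec n, 0)))
  obtain ⟨δ₁, hδ₁, hb₁⟩ := Metric.eventually_nhds_iff.1 h1
  have he : eVec n ∈ {v | v ∈ lightCone n ∧ 1 / 2 < lorentzQ n v ∧ lorentzQ n v < 2} := by
    refine ⟨⟨by simp [eVec], ?_⟩, ?_, ?_⟩ <;> rw [lorentzQ_eVec] <;> norm_num
  have hopen : IsOpen {v | v ∈ lightCone n ∧ 1 / 2 < lorentzQ n v ∧ lorentzQ n v < 2} :=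
    (isOpen_lightCone n).inter ((isOpen_lt continuous_const (continuous_lorentzQ n)).inter
      (isOpen_lt (continuous_lorentzQ n) continuous_const))
  obtain ⟨δ₂, hδ₂, hb₂⟩ := Metric.isOpen_iff.1 hopen _ he
  refine ⟨min (1 / 16) (min (δ₁ / 4) (δ₂ / 2)), by positivity, min_le_left _ _, ?_, ?_⟩
  · intro a b ha hb
    have hm : min (1 / 16) (min (δ₁ / 4) (δ₂ / 2)) ≤ δ₁ / 4 :=
      (min_le_right _ _).trans (min_le_left _ _)
    have := hb₁ (y := (a, b)) (by
      rw [Prod.dist_eq, max_lt_iff]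
      simp only [dist_eq_norm, sub_zero]
      constructor <;> linarith)
    exact this.le
  · intro v hv
    have hm : min (1 / 16) (min (δ₁ / 4) (δ₂ / 2)) ≤ δ₂ / 2 :=
      (min_le_right _ _).trans (min_le_right _ _)
    have := hb₂ (show v ∈ Metric.ball (eVec n) δ₂ by
      rw [Metric.mem_ball, dist_eq_norm]; linarith)
    exact ⟨this.1, this.2.1.le, this.2.2.le⟩

/-! ### Packets adapted to the dyadic maps -/

/-- The conclusion of `exists_kernel_bounds` for the Bergman kernel with parameter `ν`. -/
structure IsKernelRadius (n : ℕ) [NeZero n] (ν η : ℝ) : Prop where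
  pos : 0 < η
  le : η ≤ 1 / 16
  half_le_re : ∀ a b : Fin n → ℝ, ‖a - eVec n‖ ≤ 2 * η → ‖b‖ ≤ 2 * η →
    1 / 2 ≤ (lorentzQC n (fun k => (a k : ℂ) + (b k : ℂ) * I)
      ^ (((-(ν + (n : ℝ) / 2) : ℝ)) : ℂ)).re
  bounds : ∀ v : Fin n → ℝ, ‖v - eVec n‖ ≤ η →
    v ∈ lightCone n ∧ 1 / 2 ≤ lorentzQ n v ∧ lorentzQ n v ≤ 2

lemma exists_isKernelRadius (n : ℕ) [NeZero n] (ν : ℝ) : ∃ η, IsKernelRadius n ν η := by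
  obtain ⟨η, h0, h1, h2, h3⟩ := exists_kernel_bounds n (ν + (n : ℝ) / 2)
  exact ⟨η, h0, h1, h2, h3⟩

/-- The preimage under `h` of the cell of the lattice `η ℤ^n` with index `l`. -/
def tile {n : ℕ} (h : (Fin n → ℝ) →ₗ[ℝ] (Fin n → ℝ)) (η : ℝ) (l : Fin n → ℤ) :
    Set (Fin n → ℝ) :=
  {u | (fun t => ⌊h u t / η⌋) = l}

/-- The preimage under `h` of the closed ball of radius `η` around `eVec n`. -/
def eBall {n : ℕ} [NeZero n] (h : (Fin n → ℝ) →ₗ[ℝ] (Fin n → ℝ)) (η : ℝ) : Set (Fin n → ℝ) :=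
  {v | ‖h v - eVec n‖ ≤ η}

lemma tile_eq_preimage {n : ℕ} (h : (Fin n → ℝ) →ₗ[ℝ] (Fin n → ℝ)) {η : ℝ} (hη : 0 < η)
    (l : Fin n → ℤ) :
    tile h η l = h ⁻¹' Set.pi univ fun t => Ico ((l t : ℝ) * η) (((l t : ℝ) + 1) * η) := by
  ext u
  simp only [tile, mem_ofPred_eq, mem_preimage, mem_pi, mem_univ, true_imp_iff, mem_Ico,
    funext_iff, Int.floor_eq_iff, le_div_iff₀ hη, div_lt_iff₀ hη]

lemma norm_map_sub_le_of_mem_tile {n : ℕ} {h : (Fin n → ℝ) →ₗ[ℝ] (Fin n → ℝ)} {η : ℝ}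
    (hη : 0 < η) {l : Fin n → ℤ} {u x : Fin n → ℝ} (hu : u ∈ tile h η l) (hx : x ∈ tile h η l) :
    ‖h (u - x)‖ ≤ η := by
  rw [tile_eq_preimage h hη] at hu hx
  refine (pi_norm_le_iff_of_nonneg hη.le).2 fun t => ?_
  have h1 := hu t (mem_univ t)
  have h2 := hx t (mem_univ t)
  rw [map_sub, Pi.sub_apply, Real.norm_eq_abs, abs_le]
  constructor <;> nlinarith [h1.1, h1.2, h2.1, h2.2]

lemma measurableSet_tile {n : ℕ} (h : (Fin n → ℝ) →ₗ[ℝ] (Fin n → ℝ)) {η : ℝ} (hη : 0 < η)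
    (l : Fin n → ℤ) : MeasurableSet (tile h η l) := by
  rw [tile_eq_preimage h hη]
  exact h.continuous_of_finiteDimensional.measurable
    (MeasurableSet.univ_pi fun t => measurableSet_Ico)

lemma volume_tile {n : ℕ} {h : (Fin n → ℝ) →ₗ[ℝ] (Fin n → ℝ)} (hd : LinearMap.det h ≠ 0)
    {η : ℝ} (hη : 0 < η) (l : Fin n → ℤ) :
    volume (tile h η l) = ENNReal.ofReal (|LinearMap.det h|⁻¹ * η ^ n) := by
  rw [tile_eq_preimage h hη, Measure.addHaar_preimage_linearMap volume hd, Real.volume_pi_Ico,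
    ENNReal.ofReal_mul (by positivity), abs_inv]
  congr 1
  simp [add_mul, ENNReal.ofReal_pow hη.le]

lemma isClosed_eBall {n : ℕ} [NeZero n] (h : (Fin n → ℝ) →ₗ[ℝ] (Fin n → ℝ)) (η : ℝ) :
    IsClosed (eBall h η) := by
  have := h.continuous_of_finiteDimensional
  exact isClosed_le (by fun_prop) continuous_const

lemma volume_eBall {n : ℕ} [NeZero n] {h : (Fin n → ℝ) →ₗ[ℝ] (Fin n → ℝ)}
    (hd : LinearMap.det h ≠ 0) {η : ℝ} (hη : 0 < η) :
    volume (eBall h η) = ENNReal.ofReal (|LinearMap.det h|⁻¹ * (2 * η) ^ n) := by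
  have : eBall h η = h ⁻¹' Metric.closedBall (eVec n) η := by
    ext v
    simp [eBall, dist_eq_norm]
  rw [this, Measure.addHaar_preimage_linearMap volume hd, Real.volume_pi_closedBall _ hη.le,
    ENNReal.ofReal_mul (by positivity), abs_inv, Fintype.card_fin]

lemma ofReal_mul_cpow {r : ℝ} (hr : 0 < r) (z s : ℂ) :
    ((r : ℂ) * z) ^ s = (r : ℂ) ^ s * z ^ s := by
  have hr' : (r : ℂ) ≠ 0 := Complex.ofReal_ne_zero.2 hr.ne'
  rcases eq_or_ne z 0 with rfl | hz
  · rcases eq_or_ne s 0 with rfl | hs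
    · simp
    · simp [hs]
  · rw [cpow_def_of_ne_zero (mul_ne_zero hr' hz), cpow_def_of_ne_zero hr',
      cpow_def_of_ne_zero hz, log_ofReal_mul hr hz, ← ofReal_log hr.le, add_mul, Complex.exp_add]

section Dyadic

variable {m K : ℕ} {ν η : ℝ}

lemma det_dyadicMap_ne_zero (i : ParabolicIndex m K) : LinearMap.det (dyadicMap i) ≠ 0 := by
  rw [← abs_pos, det_dyadicMap]
  positivity

lemma inv_det_dyadicMap (i : ParabolicIndex m K) :
    |LinearMap.det (dyadicMap i)|⁻¹ = ((4 : ℝ) ^ (i.1 : ℕ)) ^ (((m + 2 : ℕ) : ℝ) / 2) := by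
  rw [det_dyadicMap, inv_inv, show (4 : ℝ) = 2 ^ (2 : ℝ) by norm_num, ← Real.rpow_natCast,
    ← Real.rpow_natCast, ← Real.rpow_mul (by norm_num), ← Real.rpow_mul (by norm_num)]
  congr 1
  push_cast
  ring

variable [NeZero (m + 2)]

lemma lorentzQ_eq_dyadicMap (i : ParabolicIndex m K) (v : Fin (m + 2) → ℝ) :
    lorentzQ (m + 2) v = (4 : ℝ) ^ (i.1 : ℕ) * lorentzQ (m + 2) (dyadicMap i v) := by
  rw [lorentzQ_dyadicMap, mul_inv_cancel_left₀ (by positivity)]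

lemma eBall_subset_lightCone (hη : IsKernelRadius (m + 2) ν η) (i : ParabolicIndex m K) :
    eBall (dyadicMap i) η ⊆ lightCone (m + 2) := fun _ hv =>
  mem_lightCone_of_dyadicMap_mem (hη.bounds _ hv).1

lemma weight_eq (hη : IsKernelRadius (m + 2) ν η) {i : ParabolicIndex m K} (a : ℝ)
    {v : Fin (m + 2) → ℝ} (hv : v ∈ eBall (dyadicMap i) η) :
    lorentzQ (m + 2) v ^ a
      = ((4 : ℝ) ^ (i.1 : ℕ)) ^ a * lorentzQ (m + 2) (dyadicMap i v) ^ a := by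
  rw [lorentzQ_eq_dyadicMap i v, Real.mul_rpow (by positivity) (by linarith [(hη.bounds _ hv).2.1])]

lemma weight_le (hη : IsKernelRadius (m + 2) ν η) {i : ParabolicIndex m K} (a : ℝ)
    {v : Fin (m + 2) → ℝ} (hv : v ∈ eBall (dyadicMap i) η) :
    lorentzQ (m + 2) v ^ a
      ≤ ((4 : ℝ) ^ (i.1 : ℕ)) ^ a * max ((1 / 2 : ℝ) ^ a) (2 ^ a) := by
  obtain ⟨-, h1, h2⟩ := hη.bounds _ hv
  rw [weight_eq hη a hv]
  gcongr
  exact rpow_le_max_rpow (by norm_num) h1 h2 a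

lemma le_weight (hη : IsKernelRadius (m + 2) ν η) {i : ParabolicIndex m K} (a : ℝ)
    {v : Fin (m + 2) → ℝ} (hv : v ∈ eBall (dyadicMap i) η) :
    ((4 : ℝ) ^ (i.1 : ℕ)) ^ a * min ((1 / 2 : ℝ) ^ a) (2 ^ a) ≤ lorentzQ (m + 2) v ^ a := by
  obtain ⟨-, h1, h2⟩ := hη.bounds _ hv
  rw [weight_eq hη a hv]
  gcongr
  exact min_rpow_le_rpow (by norm_num) h1 h2 a

lemma isPacket_dyadicMap (hη : IsKernelRadius (m + 2) ν η) (i : ParabolicIndex m K)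
    (l : Fin (m + 2) → ℤ) : IsPacket (m + 2) (tile (dyadicMap i) η l) (eBall (dyadicMap i) η) where
  measurableSet_left := measurableSet_tile _ hη.pos l
  measurableSet_right := (isClosed_eBall _ _).measurableSet
  volume_left_ne_top := by
    rw [volume_tile (det_dyadicMap_ne_zero i) hη.pos]
    exact ENNReal.ofReal_ne_top
  volume_right_ne_top := by
    rw [volume_eBall (det_dyadicMap_ne_zero i) hη.pos]
    exact ENNReal.ofReal_ne_top
  subset_lightCone := eBall_subset_lightCone hη i
  exists_bounds := by
    refine ⟨(4 : ℝ) ^ (i.1 : ℕ) * (1 / 2), (4 : ℝ) ^ (i.1 : ℕ) * 2, by positivity, fun v hv => ?_⟩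
    obtain ⟨-, h1, h2⟩ := hη.bounds _ hv
    rw [lorentzQ_eq_dyadicMap i v]
    constructor <;> gcongr

/-- The lower bound for the Bergman operator on a packet, see `le_re_bergmanOp_dyadicMap`. -/
def packetBound (n : ℕ) (ν η : ℝ) : ℝ :=
  1 / 2 * min ((1 / 2 : ℝ) ^ (ν - (n : ℝ) / 2)) (2 ^ (ν - (n : ℝ) / 2)) * (η ^ n * (2 * η) ^ n)

lemma packetBound_pos (n : ℕ) (ν : ℝ) {η : ℝ} (hη : 0 < η) : 0 < packetBound n ν η := by
  have : 0 < min ((1 / 2 : ℝ) ^ (ν - (n : ℝ) / 2)) (2 ^ (ν - (n : ℝ) / 2)) :=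
    lt_min (by positivity) (by positivity)
  unfold packetBound
  positivity

lemma le_re_bergmanOp_dyadicMap (hη : IsKernelRadius (m + 2) ν η)
    (hν : 0 ≤ ν + ((m + 2 : ℕ) : ℝ) / 2) {i : ParabolicIndex m K} {l : Fin (m + 2) → ℤ}
    {x y : Fin (m + 2) → ℝ} (hy : y ∈ lightCone (m + 2)) (hyη : ‖dyadicMap i y‖ ≤ η)
    (hx : ∀ u ∈ tile (dyadicMap i) η l, ‖dyadicMap i (u - x)‖ ≤ 2 * η) :
    packetBound (m + 2) ν η
      ≤ (bergmanOp (m + 2) ν (packet (tile (dyadicMap i) η l) (eBall (dyadicMap i) η))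
          (tubePt (m + 2) x y)).re := by
  set N : ℝ := ((m + 2 : ℕ) : ℝ) with hN
  set Λ : ℝ := (4 : ℝ) ^ (i.1 : ℕ) with hΛ
  have hΛ0 : 0 < Λ := by positivity
  have hη0 := hη.pos
  set c : ℝ := min ((1 / 2 : ℝ) ^ (ν - N / 2)) (2 ^ (ν - N / 2)) with hc
  have hc0 : 0 ≤ c := le_min (by positivity) (by positivity)
  have key := (isPacket_dyadicMap hη i l).le_re_bergmanOp hν hy
    (x := x) (κ := Λ ^ (-(ν + N / 2)) * (1 / 2)) (w := Λ ^ (ν - N / 2) * c)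
    (by positivity) (by positivity) (fun v hv => le_weight hη _ hv) ?_
  · refine le_trans (le_of_eq ?_) key
    rw [measureReal_def, measureReal_def, volume_tile (det_dyadicMap_ne_zero i) hη0,
      volume_eBall (det_dyadicMap_ne_zero i) hη0, ENNReal.toReal_ofReal (by positivity),
      ENNReal.toReal_ofReal (by positivity), inv_det_dyadicMap, ← hΛ, ← hN]
    have hpow : Λ ^ (-(ν + N / 2)) * Λ ^ (ν - N / 2) * Λ ^ (N / 2) * Λ ^ (N / 2) = 1 := by
      rw [← Real.rpow_add hΛ0, ← Real.rpow_add hΛ0, ← Real.rpow_add hΛ0]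
      convert Real.rpow_zero Λ using 2
      ring
    rw [packetBound, ← hN, ← hc]
    linear_combination (-(1 / 2 * c * (η ^ (m + 2) * (2 * η) ^ (m + 2)))) * hpow
  · intro u hu v hv
    have h1 : lorentzQC (m + 2) (fun k => ((y + v) k : ℂ) + ((u - x) k : ℂ) * I)
        = (Λ : ℂ) * lorentzQC (m + 2) (fun k => ((dyadicMap i (y + v) k : ℝ) : ℂ)
            + ((dyadicMap i (u - x) k : ℝ) : ℂ) * I) := by
      rw [lorentzQC_map (m + 2) (lorentzQ_dyadicMap i), ← mul_assoc, ← hΛ]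
      rw [← Complex.ofReal_mul, mul_inv_cancel₀ hΛ0.ne', Complex.ofReal_one, one_mul]
    have h2 := hη.half_le_re (dyadicMap i (y + v)) (dyadicMap i (u - x)) (by
      rw [map_add, add_sub_assoc]
      exact (norm_add_le _ _).trans (by linarith [hv.out])) (hx u hu)
    rw [h1, ofReal_mul_cpow hΛ0, ← Complex.ofReal_cpow hΛ0.le, Complex.re_ofReal_mul]
    gcongr

end Dyadic

/-! ### Mixed norms of sums of packets -/

section Dyadic

variable {m K : ℕ} [NeZero (m + 2)] {ν η : ℝ}

/-- A linear combination of packets adapted to the dyadic maps. -/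
def packetSum (η : ℝ) (s : Finset (ParabolicIndex m K × (Fin (m + 2) → ℤ)))
    (c : ParabolicIndex m K × (Fin (m + 2) → ℤ) → ℂ) : (Fin (m + 2) → ℂ) → ℂ :=
  fun z => ∑ j ∈ s, c j * packet (tile (dyadicMap j.1) η j.2) (eBall (dyadicMap j.1) η) z

lemma measurable_packetSum (hη : IsKernelRadius (m + 2) ν η)
    (s : Finset (ParabolicIndex m K × (Fin (m + 2) → ℤ)))
    (c : ParabolicIndex m K × (Fin (m + 2) → ℤ) → ℂ) : Measurable (packetSum η s c) :=
  Finset.measurable_fun_sum s fun j _ =>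
    measurable_const.mul (isPacket_dyadicMap hη j.1 j.2).measurable

lemma packetSum_tubePt_of_notMem (s : Finset (ParabolicIndex m K × (Fin (m + 2) → ℤ)))
    (c : ParabolicIndex m K × (Fin (m + 2) → ℤ) → ℂ) (u : Fin (m + 2) → ℝ)
    {v : Fin (m + 2) → ℝ} (hv : ∀ i : ParabolicIndex m K, v ∉ eBall (dyadicMap i) η) :
    packetSum η s c (tubePt (m + 2) u v) = 0 :=
  Finset.sum_eq_zero fun j _ => by
    rw [packet_tubePt_of_notMem fun h => hv j.1 h.2, mul_zero]

lemma norm_packetSum_tubePt_le (hη : IsKernelRadius (m + 2) ν η)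
    {s : Finset (ParabolicIndex m K × (Fin (m + 2) → ℤ))}
    {c : ParabolicIndex m K × (Fin (m + 2) → ℤ) → ℂ} {i : ParabolicIndex m K} {α : ℝ}
    {X : Set (Fin (m + 2) → ℝ)} (hα : 0 ≤ α) (hc : ∀ l, ‖c (i, l)‖ ≤ α)
    (hX : ∀ l, (i, l) ∈ s → tile (dyadicMap i) η l ⊆ X) (u : Fin (m + 2) → ℝ)
    {v : Fin (m + 2) → ℝ} (hv : v ∈ eBall (dyadicMap i) η) :
    ‖packetSum η s c (tubePt (m + 2) u v)‖ ≤ X.indicator (fun _ => α) u := by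
  classical
  set l : Fin (m + 2) → ℤ := fun t => ⌊dyadicMap i u t / η⌋ with hl
  have hul : u ∈ tile (dyadicMap i) η l := rfl
  have hzero : ∀ j ∈ s, j ≠ (i, l) →
      c j * packet (tile (dyadicMap j.1) η j.2) (eBall (dyadicMap j.1) η)
        (tubePt (m + 2) u v) = 0 := by
    rintro ⟨i', l'⟩ - hne
    rw [packet_tubePt_of_notMem, mul_zero]
    rintro ⟨h1, h2⟩
    obtain rfl : i' = i := dyadicMap_separated (h2.out.trans hη.le) (hv.out.trans hη.le)
    exact hne (Prod.ext rfl h1.out.symm)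
  have hind : 0 ≤ X.indicator (fun _ => α) u := indicator_nonneg (fun _ _ => hα) u
  by_cases hs : (i, l) ∈ s
  · rw [packetSum, Finset.sum_eq_single_of_mem _ hs hzero, packet_tubePt_of_mem hul hv, mul_one,
      indicator_of_mem (hX l hs hul)]
    exact hc l
  · rw [packetSum, Finset.sum_eq_zero fun j hj => hzero j hj (ne_of_mem_of_not_mem hj hs),
      norm_zero]
    exact hind

lemma mixedNorm_packetSum_le (hη : IsKernelRadius (m + 2) ν η) {p q : ℝ} (hp : 0 < p) (hq : 0 < q)
    {s : Finset (ParabolicIndex m K × (Fin (m + 2) → ℤ))}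
    {c : ParabolicIndex m K × (Fin (m + 2) → ℤ) → ℂ} {α t : ℕ → ℝ} {B : ℝ≥0∞} {D : ℝ}
    {X : ParabolicIndex m K → Set (Fin (m + 2) → ℝ)} (hα : ∀ k, 0 ≤ α k) (ht : ∀ k, 0 ≤ t k)
    (hc : ∀ j, ‖c j‖ ≤ α j.1.1) (hX : ∀ i, MeasurableSet (X i))
    (hsX : ∀ j ∈ s, tile (dyadicMap j.1) η j.2 ⊆ X j.1)
    (hXt : ∀ i, volume (X i) ≤ ENNReal.ofReal (t i.1) * B)
    (hD : ∀ k < K, 2 ^ (k * m) * ((α k ^ p * t k) ^ (q / p) * ((4 : ℝ) ^ k) ^ ν) ≤ D) :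
    mixedNorm (m + 2) p q ν (packetSum η s c)
      ≤ (K * (ENNReal.ofReal (D * (max ((1 / 2 : ℝ) ^ (ν - ((m + 2 : ℕ) : ℝ) / 2))
          (2 ^ (ν - ((m + 2 : ℕ) : ℝ) / 2)) * (2 * η) ^ (m + 2))) * B ^ (q / p))) ^ (1 / q) := by
  have hη0 := hη.pos
  set N : ℝ := ((m + 2 : ℕ) : ℝ) with hN
  set C : ℝ := max ((1 / 2 : ℝ) ^ (ν - N / 2)) (2 ^ (ν - N / 2)) with hC
  have hC0 : 0 ≤ C := le_max_of_le_left (by positivity)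
  have hqp : 0 < q / p := div_pos hq hp
  have key := mixedNorm_le_of_bound (m + 2) (p := p) (q := q) (ν := ν) hp hq (U := X)
    (V := fun i : ParabolicIndex m K => eBall (dyadicMap i) η)
    (α := fun i => ENNReal.ofReal (α i.1))
    (W := fun i => ENNReal.ofReal (((4 : ℝ) ^ (i.1 : ℕ)) ^ (ν - N / 2) * C))
    (F := packetSum η s c) hX (fun i => (isClosed_eBall _ _).measurableSet) ?_
    (fun v hv u => packetSum_tubePt_of_notMem s c u hv)
    (fun i v hv => ENNReal.ofReal_le_ofReal (weight_le hη _ hv))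
  · refine key.trans (ENNReal.rpow_le_rpow ?_ (by positivity))
    set f : ℕ → ℝ≥0∞ := fun k =>
      ENNReal.ofReal ((α k ^ p * t k) ^ (q / p) * ((4 : ℝ) ^ k) ^ ν * (C * (2 * η) ^ (m + 2)))
        * B ^ (q / p) with hf
    calc _ ≤ ∑ i : ParabolicIndex m K, f i.1 := by
          refine Finset.sum_le_sum fun i _ => ?_
          have hΛ0 : (0 : ℝ) < 4 ^ (i.1 : ℕ) := by positivity
          have h1 : (ENNReal.ofReal (α i.1) ^ p * volume (X i)) ^ (q / p)
              ≤ ENNReal.ofReal ((α i.1 ^ p * t i.1) ^ (q / p)) * B ^ (q / p) := by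
            rw [← ENNReal.ofReal_rpow_of_nonneg
                (mul_nonneg (Real.rpow_nonneg (hα _) _) (ht _)) hqp.le,
              ← ENNReal.mul_rpow_of_nonneg _ _ hqp.le,
              ENNReal.ofReal_mul (Real.rpow_nonneg (hα _) _),
              ← ENNReal.ofReal_rpow_of_nonneg (hα _) hp.le, mul_assoc]
            gcongr
            exact hXt i
          have h2 : ENNReal.ofReal (((4 : ℝ) ^ (i.1 : ℕ)) ^ (ν - N / 2) * C)
                * volume (eBall (dyadicMap i) η)
              = ENNReal.ofReal (((4 : ℝ) ^ (i.1 : ℕ)) ^ ν * (C * (2 * η) ^ (m + 2))) := by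
            rw [volume_eBall (det_dyadicMap_ne_zero i) hη0, inv_det_dyadicMap, ← hN,
              ← ENNReal.ofReal_mul (by positivity)]
            have hpow : ((4 : ℝ) ^ (i.1 : ℕ)) ^ (ν - N / 2) * ((4 : ℝ) ^ (i.1 : ℕ)) ^ (N / 2)
                = ((4 : ℝ) ^ (i.1 : ℕ)) ^ ν := by
              rw [← Real.rpow_add hΛ0]
              congr 1
              ring
            rw [← hpow]
            congr 1
            ring
          rw [h2]
          refine (mul_le_mul_left h1 _).trans (le_of_eq ?_)
          simp only [hf]
          rw [mul_assoc ((α i.1 ^ p * t i.1) ^ (q / p)), ENNReal.ofReal_mul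
            (Real.rpow_nonneg (mul_nonneg (Real.rpow_nonneg (hα _) _) (ht _)) _)]
          ring
      _ = ∑ k ∈ Finset.range K, (2 ^ (k * m)) • f k := sum_parabolicIndex f
      _ ≤ ∑ k ∈ Finset.range K, ENNReal.ofReal (D * (C * (2 * η) ^ (m + 2))) * B ^ (q / p) := by
          refine Finset.sum_le_sum fun k hk => ?_
          rw [hf, nsmul_eq_mul, ← mul_assoc]
          gcongr
          have e : ((2 ^ (k * m) : ℕ) : ℝ≥0∞) = ENNReal.ofReal (2 ^ (k * m)) := by
            rw [← ENNReal.ofReal_natCast]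
            norm_cast
          rw [e, ← ENNReal.ofReal_mul (by positivity), ← mul_assoc]
          have := hD k (Finset.mem_range.1 hk)
          gcongr
      _ = _ := by rw [Finset.sum_const, Finset.card_range, nsmul_eq_mul]
  · intro i v hv u
    have h := norm_packetSum_tubePt_le hη (X := X i) (hα i.1) (fun l => hc (i, l))
      (fun l hl => hsX (i, l) hl) u hv
    by_cases hu : u ∈ X i
    · rw [indicator_of_mem hu] at h ⊢
      rw [← ENNReal.ofReal_coe_nnreal, coe_nnnorm]
      exact ENNReal.ofReal_le_ofReal h
    · rw [indicator_of_notMem hu] at h ⊢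
      have h0 := norm_le_zero_iff.1 h
      simp [h0]

lemma mixedNorm_packetSum_lt_top (hη : IsKernelRadius (m + 2) ν η) {p q : ℝ} (hp : 0 < p)
    (hq : 0 < q) {s : Finset (ParabolicIndex m K × (Fin (m + 2) → ℤ))}
    {c : ParabolicIndex m K × (Fin (m + 2) → ℤ) → ℂ} {α t : ℕ → ℝ} {B : ℝ≥0∞} (hB : B ≠ ∞)
    {X : ParabolicIndex m K → Set (Fin (m + 2) → ℝ)} (hα : ∀ k, 0 ≤ α k) (ht : ∀ k, 0 ≤ t k)
    (hc : ∀ j, ‖c j‖ ≤ α j.1.1) (hX : ∀ i, MeasurableSet (X i))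
    (hsX : ∀ j ∈ s, tile (dyadicMap j.1) η j.2 ⊆ X j.1)
    (hXt : ∀ i, volume (X i) ≤ ENNReal.ofReal (t i.1) * B) :
    mixedNorm (m + 2) p q ν (packetSum η s c) < ∞ := by
  refine (mixedNorm_packetSum_le hη hp hq hα ht hc hX hsX hXt
    (D := ∑ k ∈ Finset.range K, 2 ^ (k * m) * ((α k ^ p * t k) ^ (q / p) * ((4 : ℝ) ^ k) ^ ν))
    fun k hk => ?_).trans_lt ?_
  · refine Finset.single_le_sum (f := fun k =>
      2 ^ (k * m) * ((α k ^ p * t k) ^ (q / p) * ((4 : ℝ) ^ k) ^ ν)) (fun k _ => ?_)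
      (Finset.mem_range.2 hk)
    have := mul_nonneg (Real.rpow_nonneg (hα k) p) (ht k)
    positivity
  · refine ENNReal.rpow_lt_top_of_nonneg (by positivity) ?_
    refine ENNReal.mul_ne_top (ENNReal.natCast_ne_top K)
      (ENNReal.mul_ne_top ENNReal.ofReal_ne_top ?_)
    exact (ENNReal.rpow_lt_top_of_nonneg (by positivity) hB).ne

end Dyadic

/-! ### Growth estimates -/

lemma not_forall_natCast_le_mul_rpow {q : ℝ} (hq : 2 < q) {A : ℝ≥0∞} (hA : A ≠ ∞) :
    ¬ ∀ K : ℕ, (K : ℝ≥0∞) ≤ A * (K : ℝ≥0∞) ^ (2 / q) := by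
  intro h
  have hq0 : 0 < q := by linarith
  have h2q : 0 < 1 - 2 / q := by
    rw [sub_pos, div_lt_one hq0]
    exact hq
  have hlim := (tendsto_rpow_atTop h2q).comp (tendsto_natCast_atTop_atTop (R := ℝ))
  obtain ⟨K, hK1, hK⟩ := ((hlim.eventually_gt_atTop A.toReal).and
    (Filter.eventually_ge_atTop 1)).exists.imp fun K h => And.symm h
  have hK0 : (0 : ℝ) < K := by exact_mod_cast hK1
  have h1 : (K : ℝ) ≤ A.toReal * (K : ℝ) ^ (2 / q) := by
    have := ENNReal.toReal_mono (ENNReal.mul_ne_top hA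
      (ENNReal.rpow_lt_top_of_nonneg (by positivity) (ENNReal.natCast_ne_top K)).ne) (h K)
    rwa [ENNReal.toReal_mul, ← ENNReal.toReal_rpow, ENNReal.toReal_natCast] at this
  have h2 : (K : ℝ) = (K : ℝ) ^ (1 - 2 / q) * (K : ℝ) ^ (2 / q) := by
    rw [← Real.rpow_add hK0, sub_add_cancel, Real.rpow_one]
  have h3 : 0 < (K : ℝ) ^ (2 / q) := by positivity
  have h4 := mul_lt_mul_of_pos_right hK h3
  simp only [Function.comp_apply] at h4
  linarith

lemma two_pow_mul_rpow_le {m k : ℕ} {p q ν a d τ : ℝ} (hp : 0 < p) (hτ : 0 < τ)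
    (h : m + 2 * ν ≤ a * q - d * q / p) :
    2 ^ (k * m) * (((((2 : ℝ) ^ k) ^ (-a)) ^ p * (((2 : ℝ) ^ k) ^ d * τ)) ^ (q / p)
      * ((4 : ℝ) ^ k) ^ ν) ≤ τ ^ (q / p) := by
  set b : ℝ := 2 ^ k with hb
  have hb1 : 1 ≤ b := one_le_pow₀ (by norm_num)
  have hb0 : 0 < b := by linarith
  have h4 : (4 : ℝ) ^ k = b ^ (2 : ℝ) := by
    rw [hb, Real.rpow_two, ← pow_mul, mul_comm, pow_mul]
    norm_num
  have h2 : (2 : ℝ) ^ (k * m) = b ^ (m : ℝ) := by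
    rw [hb, Real.rpow_natCast, pow_mul]
  rw [h4, h2, ← mul_assoc ((b ^ (-a)) ^ p), ← Real.rpow_mul hb0.le, ← Real.rpow_mul hb0.le,
    ← Real.rpow_add hb0, Real.mul_rpow (by positivity) hτ.le, ← Real.rpow_mul hb0.le]
  calc _ = b ^ (m + ((-a * p + d) * (q / p) + 2 * ν)) * τ ^ (q / p) := by
        rw [Real.rpow_add hb0, Real.rpow_add hb0]
        ring
    _ ≤ 1 * τ ^ (q / p) := by
        gcongr
        refine Real.rpow_le_one_of_one_le_of_nonpos hb1 ?_
        have : (-a * p + d) * (q / p) = -(a * q - d * q / p) := by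
          field_simp
          ring
        linarith
    _ = _ := one_mul _

lemma ofReal_le_nnnorm {z : ℂ} {r : ℝ} (h : r ≤ z.re) :
    ENNReal.ofReal r ≤ (‖z‖₊ : ℝ≥0∞) := by
  rw [← ENNReal.ofReal_coe_nnreal, coe_nnnorm]
  exact ENNReal.ofReal_le_ofReal (h.trans (Complex.re_le_norm z))

/-! ### Testing the boundedness of the Bergman operator on packets -/

section Dyadic

variable {m : ℕ} [NeZero (m + 2)] {ν η : ℝ}

lemma exists_test_region (hη : IsKernelRadius (m + 2) ν η) :
    ∃ (Y : Set (Fin (m + 2) → ℝ)) (w : ℝ), MeasurableSet Y ∧ Y ⊆ lightCone (m + 2) ∧ 0 < w ∧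
      (∀ y ∈ Y, w ≤ lorentzQ (m + 2) y ^ (ν - ((m + 2 : ℕ) : ℝ) / 2)) ∧
      volume Y ≠ 0 ∧ volume Y ≠ ∞ ∧
      ∀ (K : ℕ) (i : ParabolicIndex m K), ∀ y ∈ Y, ‖dyadicMap i y‖ ≤ η := by
  have hη0 := hη.pos
  have hη1 := hη.le
  set ρ : ℝ := η / (2 * (4 * m + 4)) with hρ
  have hρ0 : 0 < ρ := by positivity
  have hv : ∀ y ∈ Metric.closedBall (ρ • eVec (m + 2)) (ρ * η),
      ‖ρ⁻¹ • y - eVec (m + 2)‖ ≤ η := by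
    intro y hy
    rw [Metric.mem_closedBall, dist_eq_norm] at hy
    have : ρ⁻¹ • y - eVec (m + 2) = ρ⁻¹ • (y - ρ • eVec (m + 2)) := by
      rw [smul_sub, smul_smul, inv_mul_cancel₀ hρ0.ne', one_smul]
    rw [this, norm_smul, Real.norm_of_nonneg (by positivity), inv_mul_le_iff₀ hρ0]
    exact hy
  have hQ : ∀ y : Fin (m + 2) → ℝ,
      lorentzQ (m + 2) y = ρ ^ 2 * lorentzQ (m + 2) (ρ⁻¹ • y) := by
    intro y
    rw [← lorentzQ_smul, smul_smul, mul_inv_cancel₀ hρ0.ne', one_smul]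
  refine ⟨Metric.closedBall (ρ • eVec (m + 2)) (ρ * η),
    min ((ρ ^ 2 * (1 / 2)) ^ (ν - ((m + 2 : ℕ) : ℝ) / 2))
      ((ρ ^ 2 * 2) ^ (ν - ((m + 2 : ℕ) : ℝ) / 2)),
    measurableSet_closedBall, fun y hy => ?_, lt_min (by positivity) (by positivity),
    fun y hy => ?_, ?_, ?_, fun K i y hy => ?_⟩
  · have h := (hη.bounds _ (hv y hy)).1
    refine ⟨?_, ?_⟩
    · have h0 : 0 < ρ⁻¹ * y 0 := h.1
      exact pos_of_mul_pos_right h0 (by positivity)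
    · rw [hQ]
      exact mul_pos (by positivity) h.2
  · obtain ⟨-, h1, h2⟩ := hη.bounds _ (hv y hy)
    refine min_rpow_le_rpow (by positivity) ?_ ?_ _ <;>
    · rw [hQ y]
      gcongr
  · exact (Metric.measure_closedBall_pos volume _ (by positivity)).ne'
  · exact measure_closedBall_lt_top.ne
  · have he : ‖eVec (m + 2)‖ ≤ 1 := by
      refine (pi_norm_le_iff_of_nonneg zero_le_one).2 fun k => ?_
      unfold eVec
      split_ifs <;> simp
    have h1 : ‖y‖ ≤ 2 * ρ := by
      rw [Metric.mem_closedBall, dist_eq_norm] at hy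
      have h2 := norm_le_norm_sub_add y (ρ • eVec (m + 2))
      rw [norm_smul, Real.norm_of_nonneg hρ0.le] at h2
      nlinarith
    calc _ ≤ (4 * m + 4) * ‖y‖ := norm_dyadicMap_le i y
      _ ≤ (4 * m + 4) * (2 * ρ) := by gcongr
      _ = η := by rw [hρ]; field_simp

lemma lintegral_sq_bergmanOp_packetSum_le (hη : IsKernelRadius (m + 2) ν η) {p q : ℝ} (hp : 2 < p)
    (hq : 2 < q) {C : ℝ}
    (hbdd : ∀ F : (Fin (m + 2) → ℂ) → ℂ, Measurable F →
      mixedNorm (m + 2) 2 2 ν F < ∞ → mixedNorm (m + 2) p q ν F < ∞ →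
      mixedNorm (m + 2) p q ν (bergmanOp (m + 2) ν F)
        ≤ ENNReal.ofReal C * mixedNorm (m + 2) p q ν F)
    {Y : Set (Fin (m + 2) → ℝ)} {w : ℝ} (hY : MeasurableSet Y) (hYΛ : Y ⊆ lightCone (m + 2))
    (hw : 0 < w) (hwY : ∀ y ∈ Y, w ≤ lorentzQ (m + 2) y ^ (ν - ((m + 2 : ℕ) : ℝ) / 2))
    (hYtop : volume Y ≠ ∞) (D : ℝ) :
    ∃ A : ℝ≥0∞, A ≠ ∞ ∧ ∀ (K : ℕ) (s : Finset (ParabolicIndex m K × (Fin (m + 2) → ℤ)))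
      (c : ParabolicIndex m K × (Fin (m + 2) → ℤ) → ℂ) (α t : ℕ → ℝ) (B : ℝ≥0∞)
      (U : ParabolicIndex m K → Set (Fin (m + 2) → ℝ)) (X : Set (Fin (m + 2) → ℝ)),
      B ≠ ∞ → (∀ k, 0 ≤ α k) → (∀ k, 0 ≤ t k) → (∀ j, ‖c j‖ ≤ α j.1.1) →
      (∀ i, MeasurableSet (U i)) → (∀ j ∈ s, tile (dyadicMap j.1) η j.2 ⊆ U j.1) →
      (∀ i, volume (U i) ≤ ENNReal.ofReal (t i.1) * B) →
      (∀ k, 2 ^ (k * m) * ((α k ^ p * t k) ^ (q / p) * ((4 : ℝ) ^ k) ^ ν) ≤ D) →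
      ∫⁻ y in Y, ∫⁻ x in X,
          (‖bergmanOp (m + 2) ν (packetSum η s c) (tubePt (m + 2) x y)‖₊ : ℝ≥0∞) ^ 2
        ≤ A * (volume X ^ (1 - 2 / p) * B ^ (2 / p)) * (K : ℝ≥0∞) ^ (2 / q) := by
  have hp0 : 0 < p := by linarith
  have hq0 : 0 < q := by linarith
  set E : ℝ≥0∞ := ENNReal.ofReal (D * (max ((1 / 2 : ℝ) ^ (ν - ((m + 2 : ℕ) : ℝ) / 2))
          (2 ^ (ν - ((m + 2 : ℕ) : ℝ) / 2)) * (2 * η) ^ (m + 2))) with hE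
  refine ⟨((ENNReal.ofReal w)⁻¹ ^ (2 / q) * volume Y ^ (1 - 2 / q))
    * (ENNReal.ofReal C ^ 2 * E ^ (2 / q)), ?_, ?_⟩
  · have h1 : (ENNReal.ofReal w)⁻¹ ≠ ∞ := ENNReal.inv_ne_top.2 (ENNReal.ofReal_pos.2 hw).ne'
    have h2 : 0 ≤ 1 - 2 / q := by
      rw [sub_nonneg, div_le_one hq0]
      exact hq.le
    refine ENNReal.mul_ne_top (ENNReal.mul_ne_top ?_ ?_) (ENNReal.mul_ne_top ?_ ?_)
    · exact (ENNReal.rpow_lt_top_of_nonneg (by positivity) h1).ne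
    · exact (ENNReal.rpow_lt_top_of_nonneg h2 hYtop).ne
    · exact ENNReal.pow_ne_top ENNReal.ofReal_ne_top
    · exact (ENNReal.rpow_lt_top_of_nonneg (by positivity) ENNReal.ofReal_ne_top).ne
  · intro K s c α t B U X hB hα ht hc hU hsU hUt hD
    have hFm := measurable_packetSum hη s c
    have hle := hbdd _ hFm
      (mixedNorm_packetSum_lt_top hη two_pos two_pos hB hα ht hc hU hsU hUt)
      (mixedNorm_packetSum_lt_top hη hp0 hq0 hB hα ht hc hU hsU hUt)
    have hnorm := mixedNorm_packetSum_le hη hp0 hq0 hα ht hc hU hsU hUt fun k _ => hD k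
    rw [← hE] at hnorm
    have hGm : Measurable fun yx : (Fin (m + 2) → ℝ) × (Fin (m + 2) → ℝ) =>
        bergmanOp (m + 2) ν (packetSum η s c) (tubePt (m + 2) yx.2 yx.1) :=
      (measurable_bergmanOp (m + 2) ν hFm).comp ((measurable_tubePt (m + 2)).comp measurable_swap)
    refine (lintegral_lintegral_sq_le_mixedNorm (m + 2) hp hq hGm hY hYΛ hw hwY).trans ?_
    have h1 : mixedNorm (m + 2) p q ν (bergmanOp (m + 2) ν (packetSum η s c)) ^ 2
        ≤ ENNReal.ofReal C ^ 2 * ((K : ℝ≥0∞) ^ (2 / q) * (E ^ (2 / q) * B ^ (2 / p))) := by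
      have h2 : ((K * (E * B ^ (q / p))) ^ (1 / q)) ^ 2
          = (K : ℝ≥0∞) ^ (2 / q) * (E ^ (2 / q) * B ^ (2 / p)) := by
        have h3 : 0 ≤ 2 / q := by positivity
        rw [← ENNReal.rpow_natCast, ← ENNReal.rpow_mul,
          show 1 / q * ((2 : ℕ) : ℝ) = 2 / q by push_cast; ring,
          ENNReal.mul_rpow_of_nonneg _ _ h3, ENNReal.mul_rpow_of_nonneg _ _ h3,
          ← ENNReal.rpow_mul]
        congr 3
        field_simp
      rw [← h2, ← mul_pow]
      gcongr
      exact hle.trans (by gcongr)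
    refine (mul_le_mul_right h1 _).trans (le_of_eq ?_)
    ring

end Dyadic

section Dyadic

variable {m : ℕ} [NeZero (m + 2)] {ν η : ℝ}

lemma mul_volume_le_setLIntegral_setLIntegral {n : ℕ} {X Y : Set (Fin n → ℝ)}
    (hX : MeasurableSet X) (hY : MeasurableSet Y) {f : (Fin n → ℝ) → (Fin n → ℝ) → ℝ≥0∞}
    {a : ℝ≥0∞} (h : ∀ y ∈ Y, ∀ x ∈ X, a ≤ f x y) :
    a * volume X * volume Y ≤ ∫⁻ y in Y, ∫⁻ x in X, f x y := by
  rw [← setLIntegral_const]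
  refine setLIntegral_mono' hY fun y hy => ?_
  rw [← setLIntegral_const]
  exact setLIntegral_mono' hX fun x hx => h y hy x hx

lemma bergmanOp_packetSum (hη : IsKernelRadius (m + 2) ν η)
    (hν : 0 ≤ ν + ((m + 2 : ℕ) : ℝ) / 2) {K : ℕ}
    (s : Finset (ParabolicIndex m K × (Fin (m + 2) → ℤ)))
    (c : ParabolicIndex m K × (Fin (m + 2) → ℤ) → ℂ) {x y : Fin (m + 2) → ℝ}
    (hy : y ∈ lightCone (m + 2)) :
    bergmanOp (m + 2) ν (packetSum η s c) (tubePt (m + 2) x y)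
      = ∑ j ∈ s, c j * bergmanOp (m + 2) ν
          (packet (tile (dyadicMap j.1) η j.2) (eBall (dyadicMap j.1) η)) (tubePt (m + 2) x y) :=
  bergmanOp_sum_packet hν s c (fun j _ => isPacket_dyadicMap hη j.1 j.2) hy

lemma four_pow_rpow_half (k : ℕ) (r : ℝ) : ((4 : ℝ) ^ k) ^ (r / 2) = ((2 : ℝ) ^ k) ^ r := by
  rw [show (4 : ℝ) = 2 ^ 2 by norm_num, ← pow_mul, mul_comm, pow_mul, ← Real.rpow_natCast _ 2,
    ← Real.rpow_mul (by positivity)]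
  congr 1
  push_cast
  ring

lemma sum_rpow_neg_parabolicIndex (m K : ℕ) :
    ∑ i : ParabolicIndex m K, ((2 : ℝ) ^ (i.1 : ℕ)) ^ (-(m : ℝ)) = K := by
  rw [sum_parabolicIndex fun k => ((2 : ℝ) ^ k) ^ (-(m : ℝ))]
  have : ∀ k ∈ Finset.range K, (2 ^ (k * m)) • ((2 : ℝ) ^ k) ^ (-(m : ℝ)) = 1 := by
    intro k _
    have hb : (0 : ℝ) < 2 ^ k := by positivity
    rw [nsmul_eq_mul, Real.rpow_neg hb.le, Real.rpow_natCast, ← pow_mul]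
    push_cast
    exact mul_inv_cancel₀ (by positivity)
  rw [Finset.sum_congr rfl this]
  simp

lemma not_bounded_of_le_sub (hν : 0 ≤ ν + ((m + 2 : ℕ) : ℝ) / 2) {p q : ℝ} (hp : 2 < p)
    (hq : 2 < q) (h : m + 2 * ν ≤ m * q - ((m + 2 : ℕ) : ℝ) * q / p) {C : ℝ}
    (hbdd : ∀ F : (Fin (m + 2) → ℂ) → ℂ, Measurable F →
      mixedNorm (m + 2) 2 2 ν F < ∞ → mixedNorm (m + 2) p q ν F < ∞ →
      mixedNorm (m + 2) p q ν (bergmanOp (m + 2) ν F)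
        ≤ ENNReal.ofReal C * mixedNorm (m + 2) p q ν F) : False := by
  obtain ⟨η, hη⟩ := exists_isKernelRadius (m + 2) ν
  have hη0 := hη.pos
  obtain ⟨Y, w, hY, hYΛ, hw, hwY, hY0, hYtop, hYη⟩ := exists_test_region hη
  set N : ℝ := ((m + 2 : ℕ) : ℝ) with hN
  obtain ⟨A, hA, hle⟩ := lintegral_sq_bergmanOp_packetSum_le hη hp hq hbdd hY hYΛ hw hwY hYtop
    ((η ^ (m + 2)) ^ (q / p))
  set X : Set (Fin (m + 2) → ℝ) := Metric.closedBall 0 (η / (4 * m + 4)) with hX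
  have hX0 : volume X ≠ 0 := (Metric.measure_closedBall_pos volume _ (by positivity)).ne'
  have hXtop : volume X ≠ ∞ := measure_closedBall_lt_top.ne
  set c₀ : ℝ := packetBound (m + 2) ν η with hc₀
  have hc₀0 : 0 < c₀ := packetBound_pos _ _ hη0
  set a : ℝ≥0∞ := ENNReal.ofReal c₀ ^ 2 * volume X * volume Y with ha
  have ha0 : a ≠ 0 := by
    have : ENNReal.ofReal c₀ ^ 2 ≠ 0 := pow_ne_zero _ (ENNReal.ofReal_pos.2 hc₀0).ne'
    exact mul_ne_zero (mul_ne_zero this hX0) hY0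
  have hatop : a ≠ ∞ := ENNReal.mul_ne_top
    (ENNReal.mul_ne_top (ENNReal.pow_ne_top ENNReal.ofReal_ne_top) hXtop) hYtop
  have hpX : volume X ^ (1 - 2 / p) ≠ ∞ := by
    refine (ENNReal.rpow_lt_top_of_nonneg ?_ hXtop).ne
    rw [sub_nonneg, div_le_one (by linarith)]
    exact hp.le
  refine not_forall_natCast_le_mul_rpow hq (A := A * volume X ^ (1 - 2 / p) / a)
    (ENNReal.div_ne_top (ENNReal.mul_ne_top hA hpX) ha0) fun K => ?_
  set c : ParabolicIndex m K × (Fin (m + 2) → ℤ) → ℂ :=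
    fun j => ((((2 : ℝ) ^ (j.1.1 : ℕ)) ^ (-(m : ℝ)) : ℝ) : ℂ) with hc
  have hupper := hle K (Finset.univ ×ˢ {0}) c (fun k => ((2 : ℝ) ^ k) ^ (-(m : ℝ)))
    (fun k => ((2 : ℝ) ^ k) ^ N * η ^ (m + 2)) 1 (fun i => tile (dyadicMap i) η 0) X
    ENNReal.one_ne_top (fun k => by positivity) (fun k => by positivity)
    (fun j => by
      rw [hc, Complex.norm_real, Real.norm_of_nonneg (by positivity)])
    (fun i => measurableSet_tile _ hη0 _)
    (fun j hj => by
      rw [Finset.mem_singleton.1 (Finset.mem_product.1 hj).2])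
    (fun i => by
      rw [volume_tile (det_dyadicMap_ne_zero i) hη0, inv_det_dyadicMap, mul_one, ← hN]
      refine ENNReal.ofReal_le_ofReal (le_of_eq ?_)
      rw [four_pow_rpow_half])
    (fun k => two_pow_mul_rpow_le (by linarith) (by positivity) h)
  rw [ENNReal.one_rpow, mul_one] at hupper
  have hlower : (K : ℝ≥0∞) ^ 2 * a ≤ ∫⁻ y in Y, ∫⁻ x in X,
      (‖bergmanOp (m + 2) ν (packetSum η (Finset.univ ×ˢ {0}) c)
        (tubePt (m + 2) x y)‖₊ : ℝ≥0∞) ^ 2 := by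
    refine le_trans (le_of_eq ?_) (mul_volume_le_setLIntegral_setLIntegral
      (a := ENNReal.ofReal (K * c₀) ^ 2) measurableSet_closedBall hY fun y hy x hx => ?_)
    · rw [ENNReal.ofReal_mul (by positivity), ENNReal.ofReal_natCast, ha]
      ring
    · have hyΛ := hYΛ hy
      gcongr
      refine ofReal_le_nnnorm ?_
      rw [bergmanOp_packetSum hη hν _ _ hyΛ, Complex.re_sum, Finset.sum_product,
        ← sum_rpow_neg_parabolicIndex m K, Finset.sum_mul]
      refine Finset.sum_le_sum fun i _ => ?_
      rw [Finset.sum_singleton, hc, Complex.re_ofReal_mul]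
      refine mul_le_mul_of_nonneg_left (le_re_bergmanOp_dyadicMap hη hν hyΛ (hYη K i y hy)
        fun u hu => ?_) (by positivity)
      have h0 : (0 : Fin (m + 2) → ℝ) ∈ tile (dyadicMap i) η 0 := by
        simp only [tile, mem_ofPred_eq, map_zero, Pi.zero_apply, zero_div, Int.floor_zero]
        rfl
      have h1 := norm_map_sub_le_of_mem_tile hη0 hu h0
      rw [sub_zero] at h1
      have h2 : ‖dyadicMap i x‖ ≤ η := by
        rw [mem_closedBall_zero_iff, le_div_iff₀ (by positivity)] at hx
        exact (norm_dyadicMap_le i x).trans (by linarith)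
      rw [map_sub]
      exact (norm_sub_le _ _).trans (by linarith)
  have hK : (K : ℝ≥0∞) ≤ (K : ℝ≥0∞) ^ 2 := by exact_mod_cast Nat.le_self_pow two_ne_zero K
  rw [← ENNReal.mul_div_right_comm, ENNReal.le_div_iff_mul_le (Or.inl ha0) (Or.inl hatop)]
  exact (mul_le_mul_left hK a).trans (hlower.trans hupper)

end Dyadic

lemma exists_norm_le_of_norm_dyadicMap_le (m K : ℕ) (η : ℝ) :
    ∃ R : ℝ, 0 < R ∧ ∀ (i : ParabolicIndex m K) (z : Fin (m + 2) → ℝ),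
      ‖dyadicMap i z‖ ≤ η → ‖z‖ ≤ R := by
  have h : ∀ i : ParabolicIndex m K, ∃ R : ℝ, ∀ z : Fin (m + 2) → ℝ,
      ‖dyadicMap i z‖ ≤ η → ‖z‖ ≤ R := by
    intro i
    set e := ((dyadicMap i).equivOfDetNeZero (det_dyadicMap_ne_zero i)).toContinuousLinearEquiv
    refine ⟨‖(e.symm : (Fin (m + 2) → ℝ) →L[ℝ] (Fin (m + 2) → ℝ))‖ * η, fun z hz => ?_⟩
    have h1 : e z = dyadicMap i z := rfl
    have h2 := (e.symm : (Fin (m + 2) → ℝ) →L[ℝ] (Fin (m + 2) → ℝ)).le_opNorm (e z)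
    rw [ContinuousLinearEquiv.coe_coe, e.symm_apply_apply, h1] at h2
    exact h2.trans (by gcongr)
  choose R hR using h
  obtain ⟨M, hM⟩ := (Set.finite_range R).bddAbove
  exact ⟨max M 1, by positivity, fun i z hz =>
    (hR i z hz).trans ((hM (Set.mem_range_self i)).trans (le_max_left _ _))⟩

lemma volume_closedBall_two_mul {n : ℕ} {R : ℝ} (hR : 0 ≤ R) :
    volume (Metric.closedBall (0 : Fin n → ℝ) (2 * R))
      = 2 ^ n * volume (Metric.closedBall (0 : Fin n → ℝ) R) := by
  rw [Real.volume_pi_closedBall _ (by positivity), Real.volume_pi_closedBall _ hR,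
    mul_pow 2 (2 * R), ENNReal.ofReal_mul (by positivity), Fintype.card_fin,
    ENNReal.ofReal_pow zero_le_two, ENNReal.ofReal_ofNat]

lemma exists_finset_cover_tile (m K : ℕ) {η R : ℝ} (hη : 0 < η) :
    ∃ L : Finset (Fin (m + 2) → ℤ), ∀ i : ParabolicIndex m K,
      Metric.closedBall 0 R ⊆ ⋃ l ∈ L, tile (dyadicMap i) η l := by
  set M : ℤ := ⌈(4 * m + 4) * R / η⌉ + 1 with hM
  refine ⟨Fintype.piFinset fun _ => Finset.Icc (-M) M, fun i x hx => ?_⟩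
  rw [mem_closedBall_zero_iff] at hx
  refine mem_iUnion₂.2 ⟨fun t => ⌊dyadicMap i x t / η⌋, ?_, rfl⟩
  rw [Fintype.mem_piFinset]
  intro t
  have h1 : |dyadicMap i x t| ≤ (4 * m + 4) * R := by
    refine (norm_le_pi_norm _ t).trans ((norm_dyadicMap_le i x).trans ?_)
    gcongr
  have h2 : |dyadicMap i x t / η| ≤ (4 * m + 4) * R / η := by
    rw [abs_div, abs_of_pos hη]
    gcongr
  have h3 := Int.le_ceil ((4 * m + 4) * R / η)
  have hMr : (M : ℝ) = ⌈(4 * m + 4) * R / η⌉ + 1 := by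
    rw [hM]
    push_cast
    rfl
  rw [abs_le] at h2
  rw [Finset.mem_Icc]
  constructor
  · rw [Int.le_floor]
    push_cast
    linarith
  · rw [← Int.cast_le (R := ℝ)]
    exact (Int.floor_le _).trans (by linarith)

section Dyadic

variable {m : ℕ} [NeZero (m + 2)] {ν η : ℝ}

lemma not_bounded_of_le_half (hν : 0 ≤ ν + ((m + 2 : ℕ) : ℝ) / 2) {p q : ℝ} (hp : 2 < p)
    (hq : 2 < q) (h : m + 2 * ν ≤ m / 2 * q) {C : ℝ}
    (hbdd : ∀ F : (Fin (m + 2) → ℂ) → ℂ, Measurable F →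
      mixedNorm (m + 2) 2 2 ν F < ∞ → mixedNorm (m + 2) p q ν F < ∞ →
      mixedNorm (m + 2) p q ν (bergmanOp (m + 2) ν F)
        ≤ ENNReal.ofReal C * mixedNorm (m + 2) p q ν F) : False := by
  classical
  obtain ⟨η, hη⟩ := exists_isKernelRadius (m + 2) ν
  have hη0 := hη.pos
  have hp0 : 0 < p := by linarith
  obtain ⟨Y, w, hY, hYΛ, hw, hwY, hY0, hYtop, hYη⟩ := exists_test_region hη
  obtain ⟨A, hA, hle⟩ := lintegral_sq_bergmanOp_packetSum_le hη hp hq hbdd hY hYΛ hw hwY hYtop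
    (1 ^ (q / p))
  set c₀ : ℝ := packetBound (m + 2) ν η with hc₀
  have hc₀0 : 0 < c₀ := packetBound_pos _ _ hη0
  set a : ℝ≥0∞ := ENNReal.ofReal c₀ ^ 2 * volume Y with ha
  have ha0 : a ≠ 0 := mul_ne_zero (pow_ne_zero _ (ENNReal.ofReal_pos.2 hc₀0).ne') hY0
  have hatop : a ≠ ∞ := ENNReal.mul_ne_top (ENNReal.pow_ne_top ENNReal.ofReal_ne_top) hYtop
  set A' : ℝ≥0∞ := A * (2 ^ (m + 2)) ^ (2 / p) with hA'
  have hA'top : A' ≠ ∞ := ENNReal.mul_ne_top hA (ENNReal.rpow_lt_top_of_nonneg (by positivity)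
    (ENNReal.pow_ne_top ENNReal.ofNat_ne_top)).ne
  refine not_forall_natCast_le_mul_rpow hq (A := A' / a) (ENNReal.div_ne_top hA'top ha0)
    fun K => ?_
  obtain ⟨R, hR0, hR⟩ := exists_norm_le_of_norm_dyadicMap_le m K η
  obtain ⟨L, hL⟩ := exists_finset_cover_tile m K (R := R) hη0
  set X : Set (Fin (m + 2) → ℝ) := Metric.closedBall 0 R with hX
  have hXm : MeasurableSet X := measurableSet_closedBall
  have hX0 : volume X ≠ 0 := (Metric.measure_closedBall_pos volume _ hR0).ne'
  have hXtop : volume X ≠ ∞ := measure_closedBall_lt_top.ne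
  set X₂ : Set (Fin (m + 2) → ℝ) := Metric.closedBall 0 (2 * R) with hX₂
  have htile : ∀ (i : ParabolicIndex m K) (l : Fin (m + 2) → ℤ),
      (X ∩ tile (dyadicMap i) η l).Nonempty → tile (dyadicMap i) η l ⊆ X₂ := by
    rintro i l ⟨x, hxX, hx⟩ u hu
    rw [hX, mem_closedBall_zero_iff] at hxX
    rw [hX₂, mem_closedBall_zero_iff]
    have h1 := hR i _ (norm_map_sub_le_of_mem_tile hη0 hu hx)
    have h2 := norm_le_norm_sub_add u x
    linarith
  set s : Finset (ParabolicIndex m K × (Fin (m + 2) → ℤ)) :=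
    (Finset.univ ×ˢ L).filter fun j => tile (dyadicMap j.1) η j.2 ⊆ X₂ with hs
  set α : ℕ → ℝ := fun k => ((2 : ℝ) ^ k) ^ (-(m / 2 : ℝ)) with hα
  have hα0 : ∀ k, 0 ≤ α k := fun k => by positivity
  set T : ParabolicIndex m K × (Fin (m + 2) → ℤ) → (Fin (m + 2) → ℝ) × (Fin (m + 2) → ℝ) → ℂ :=
    fun j ω => bergmanOp (m + 2) ν (packet (tile (dyadicMap j.1) η j.2) (eBall (dyadicMap j.1) η))
      (tubePt (m + 2) ω.2 ω.1) with hT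
  have hTm : ∀ j, Measurable fun ω => (α j.1.1 : ℂ) * T j ω := fun j =>
    measurable_const.mul ((measurable_bergmanOp (m + 2) ν
      (isPacket_dyadicMap hη j.1 j.2).measurable).comp
        ((measurable_tubePt (m + 2)).comp measurable_swap))
  obtain ⟨ε, hε, hsum⟩ := exists_signs_lintegral_sq
    ((volume.restrict Y).prod (volume.restrict X)) s fun j _ => hTm j
  set c : ParabolicIndex m K × (Fin (m + 2) → ℤ) → ℂ := fun j => ε j * (α j.1.1 : ℂ) with hc
  have hupper := hle K s c α (fun k => ((2 : ℝ) ^ k) ^ (0 : ℝ) * 1) (volume X₂) (fun _ => X₂) X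
    measure_closedBall_lt_top.ne hα0 (fun k => by positivity)
    (fun j => by
      rw [hc, norm_mul, hε, one_mul, Complex.norm_real, Real.norm_of_nonneg (hα0 _)])
    (fun i => measurableSet_closedBall)
    (fun j hj => (Finset.mem_filter.1 hj).2)
    (fun i => by simp)
    (fun k => two_pow_mul_rpow_le hp0 one_pos (by rwa [zero_mul, zero_div, sub_zero]))
  have hsigns : ∫⁻ ω, (‖∑ j ∈ s, ε j * ((α j.1.1 : ℂ) * T j ω)‖₊ : ℝ≥0∞) ^ 2
        ∂((volume.restrict Y).prod (volume.restrict X))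
      = ∫⁻ y in Y, ∫⁻ x in X,
        (‖bergmanOp (m + 2) ν (packetSum η s c) (tubePt (m + 2) x y)‖₊ : ℝ≥0∞) ^ 2 := by
    have hm : Measurable fun ω => ∑ j ∈ s, ε j * ((α j.1.1 : ℂ) * T j ω) :=
      Finset.measurable_fun_sum s fun j _ => (hTm j).const_mul (ε j)
    rw [lintegral_prod _ (hm.nnnorm.coe_nnreal_ennreal.pow_const 2).aemeasurable]
    refine setLIntegral_congr_fun hY fun y hy => ?_
    refine lintegral_congr fun x => ?_
    rw [bergmanOp_packetSum hη hν s c (hYΛ hy)]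
    simp only [hc, hT, mul_assoc]
  have hterm : ∀ j, ENNReal.ofReal (α j.1.1 * c₀) ^ 2
        * volume (X ∩ tile (dyadicMap j.1) η j.2) * volume Y
      ≤ ∫⁻ ω, (‖(α j.1.1 : ℂ) * T j ω‖₊ : ℝ≥0∞) ^ 2
        ∂((volume.restrict Y).prod (volume.restrict X)) := by
    intro j
    rw [lintegral_prod _ ((hTm j).nnnorm.coe_nnreal_ennreal.pow_const 2).aemeasurable]
    refine (mul_volume_le_setLIntegral_setLIntegral
      (hXm.inter (measurableSet_tile _ hη0 _)) hY fun y hy x hx => ?_).trans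
      (lintegral_mono fun y => lintegral_mono_set inter_subset_left)
    gcongr
    refine ofReal_le_nnnorm ?_
    rw [Complex.re_ofReal_mul]
    refine mul_le_mul_of_nonneg_left (le_re_bergmanOp_dyadicMap hη hν (hYΛ hy) (hYη K j.1 y hy)
      fun u hu => ?_) (hα0 _)
    exact (norm_map_sub_le_of_mem_tile hη0 hu hx.2).trans (by linarith)
  have hlower : (K : ℝ≥0∞) * (a * volume X)
      ≤ ∑ j ∈ s, ∫⁻ ω, (‖(α j.1.1 : ℂ) * T j ω‖₊ : ℝ≥0∞) ^ 2
        ∂((volume.restrict Y).prod (volume.restrict X)) := by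
    calc (K : ℝ≥0∞) * (a * volume X)
        = ∑ i : ParabolicIndex m K, ENNReal.ofReal (α i.1 * c₀) ^ 2 * volume X * volume Y := by
          rw [← ENNReal.ofReal_natCast, ← sum_rpow_neg_parabolicIndex m K,
            ENNReal.ofReal_sum_of_nonneg fun i _ => by positivity, Finset.sum_mul]
          refine Finset.sum_congr rfl fun i _ => ?_
          have hsq : ((2 : ℝ) ^ (i.1 : ℕ)) ^ (-(m : ℝ)) = α i.1 ^ 2 := by
            simp only [hα]
            rw [← Real.rpow_mul_natCast (by positivity)]
            congr 1
            push_cast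
            ring
          rw [hsq, ENNReal.ofReal_mul (hα0 _), ENNReal.ofReal_pow (hα0 _), ha, mul_pow]
          ring
      _ ≤ ∑ i : ParabolicIndex m K, ∑ l ∈ L, ENNReal.ofReal (α i.1 * c₀) ^ 2
            * volume (X ∩ tile (dyadicMap i) η l) * volume Y := by
          refine Finset.sum_le_sum fun i _ => ?_
          rw [← Finset.sum_mul, ← Finset.mul_sum]
          gcongr
          refine le_trans (measure_mono ?_) (measure_biUnion_finset_le L _)
          rw [← inter_iUnion₂]
          exact subset_inter subset_rfl (hL i)
      _ = ∑ j ∈ s, ENNReal.ofReal (α j.1.1 * c₀) ^ 2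
            * volume (X ∩ tile (dyadicMap j.1) η j.2) * volume Y := by
          rw [hs, Finset.sum_filter_of_ne, Finset.sum_product]
          intro j _ hj
          refine htile j.1 j.2 ?_
          by_contra hne
          rw [not_nonempty_iff_eq_empty] at hne
          exact hj (by rw [hne, measure_empty, mul_zero, zero_mul])
      _ ≤ _ := Finset.sum_le_sum fun j _ => hterm j
  have hfinal := hlower.trans (hsum.trans (hsigns.le.trans hupper))
  have hvol : volume X ^ (1 - 2 / p) * volume X₂ ^ (2 / p)
      = (2 ^ (m + 2)) ^ (2 / p) * volume X := by
    rw [hX₂, volume_closedBall_two_mul hR0.le, ← hX, ENNReal.mul_rpow_of_nonneg _ _ (by positivity),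
      mul_left_comm, ← ENNReal.rpow_add _ _ hX0 hXtop, sub_add_cancel, ENNReal.rpow_one]
  rw [hvol] at hfinal
  have hfinal' : (K : ℝ≥0∞) * a * volume X ≤ A' * (K : ℝ≥0∞) ^ (2 / q) * volume X := by
    refine le_trans (le_of_eq (by ring)) (hfinal.trans (le_of_eq ?_))
    rw [hA']
    ring
  rw [← ENNReal.mul_div_right_comm, ENNReal.le_div_iff_mul_le (Or.inl ha0) (Or.inl hatop)]
  exact (ENNReal.mul_le_mul_iff_left hX0 hXtop).1 hfinal'

end Dyadic

/-- For `n ≥ 3`, `ν > n/2 − 1`, `2 < p < ∞` and `q < ∞` with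
`q ≥ min{2 q_ν, q̃_{ν,p}}`, the weighted Bergman projection admits no bounded
extension to `L^{p,q}_ν`. -/
theorem statement2 (n : ℕ) [NeZero n] (hn : 3 ≤ n) (ν p q : ℝ)
    (hν : (n : ℝ) / 2 - 1 < ν) (hp : 2 < p)
    (hq : min (ENNReal.ofReal (2 * qnu n ν)) (qtilde n ν p) ≤ ENNReal.ofReal q) :
    ¬ ∃ C : ℝ, 0 < C ∧
        ∀ F : (Fin n → ℂ) → ℂ, Measurable F →
          mixedNorm n 2 2 ν F < ∞ → mixedNorm n p q ν F < ∞ →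
          mixedNorm n p q ν (bergmanOp n ν F) ≤ ENNReal.ofReal C * mixedNorm n p q ν F := by
  rintro ⟨C, -, hbdd⟩
  obtain ⟨m, rfl⟩ : ∃ m, n = m + 2 := ⟨n - 2, by omega⟩
  have hm : (1 : ℝ) ≤ m := by exact_mod_cast (by omega : 1 ≤ m)
  have hcast : ((m + 2 : ℕ) : ℝ) = m + 2 := by push_cast; rfl
  have hν' : (m : ℝ) / 2 < ν := by rw [hcast] at hν; linarith
  have hν0 : 0 ≤ ν + ((m + 2 : ℕ) : ℝ) / 2 := by rw [hcast]; linarith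
  rcases min_le_iff.1 hq with h | h
  · have hden : (0 : ℝ) < m / 2 := by linarith
    have hqnu : qnu (m + 2) ν = (ν + m / 2) / (m / 2) := by
      rw [qnu, hcast]
      congr 1 <;> ring
    have hlt : 2 < qnu (m + 2) ν := by
      rw [hqnu, lt_div_iff₀ hden]
      linarith
    have hle : 2 * qnu (m + 2) ν ≤ q := (ENNReal.ofReal_le_ofReal_iff'.1 h).resolve_right
      (by linarith)
    refine not_bounded_of_le_half hν0 hp (by linarith) ?_ hbdd
    have h1 := mul_le_mul_of_nonneg_left hle hden.le
    rw [hqnu] at h1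
    have h2 : (m : ℝ) / 2 * (2 * ((ν + m / 2) / (m / 2))) = m + 2 * ν := by
      field_simp
      ring
    linarith
  · rw [qtilde] at h
    split_ifs at h with hp'
    · have hden : 0 < ((m + 2 : ℕ) : ℝ) / 2 * (1 - 1 / p) - 1 := sub_pos.2 hp'
      have hpinv : 0 < 1 / p := by positivity
      have hden' : ((m + 2 : ℕ) : ℝ) / 2 * (1 - 1 / p) - 1 < m / 2 := by
        rw [hcast]
        nlinarith
      have hlt : 2 < (ν + ((m + 2 : ℕ) : ℝ) / 2 - 1)
          / (((m + 2 : ℕ) : ℝ) / 2 * (1 - 1 / p) - 1) := by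
        rw [lt_div_iff₀ hden]
        rw [hcast] at hden' ⊢
        linarith
      have hle := (ENNReal.ofReal_le_ofReal_iff'.1 h).resolve_right (by linarith)
      refine not_bounded_of_le_sub hν0 hp (by linarith) ?_ hbdd
      rw [div_le_iff₀ hden, hcast] at hle
      rw [hcast, mul_div_assoc, div_eq_mul_one_div q p]
      linarith
    · exact ENNReal.ofReal_ne_top (top_le_iff.1 h)
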